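/- arXiv:1909.01243 — 4 statements merged into one kernel-verified Lean document; each statement's English description precedes it below -/
import Mathlib

section
/- Let u be the classical solution of the two-parameter singularly perturbed boundary value problem. Then there exist constants K > 0 and C > 0, independent of ε₁, ε₂ and u, such that for every n ∈ ℕ₀, ‖u⁽ⁿ⁾‖_{∞,(0,1)} ≤ C · Kⁿ · (max{n, ε₁⁻¹, ε₂⁻¹})ⁿ. -/
open Set

/-- At a local maximum of a continuous function the second derivative is nonpositive. -/
theorem IsLocalMax.deriv_deriv_nonpos {u : ℝ → ℝ} {x : ℝ} (h : IsLocalMax u x)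
    (hc : ContinuousAt u x) : deriv (deriv u) x ≤ 0 := by
  by_contra! hpos
  have hmin := isLocalMin_of_deriv_deriv_pos hpos h.deriv_eq_zero hc
  have heq : u =ᶠ[nhds x] fun _ => u x := by
    filter_upwards [h, hmin] with y h1 h2 using le_antisymm h1 h2
  have h0 : deriv (deriv u) x = 0 := by
    rw [heq.deriv.deriv_eq]
    simp
  linarith

/-- Weak maximum principle for `-ε u'' + p u' + c u ≤ F` with zero boundary values. -/
theorem le_div_of_elliptic_le {u p c : ℝ → ℝ} {ε γ F : ℝ} (hu : Continuous u)
    (hε : 0 < ε) (hγ : 0 < γ) (hF : 0 ≤ F) (hc : ∀ x ∈ Ioo (0 : ℝ) 1, γ ≤ c x)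
    (h : ∀ x ∈ Ioo (0 : ℝ) 1, -ε * deriv (deriv u) x + p x * deriv u x + c x * u x ≤ F)
    (h0 : u 0 = 0) (h1 : u 1 = 0) : ∀ x ∈ Icc (0 : ℝ) 1, u x ≤ F / γ := by
  obtain ⟨y, hy, hmax⟩ := isCompact_Icc.exists_isMaxOn (nonempty_Icc.2 zero_le_one)
    (hu.continuousOn (s := Icc (0 : ℝ) 1))
  intro x hx
  refine (hmax hx).trans ?_
  rcases le_or_gt (u y) 0 with hn | hp
  · exact hn.trans (by positivity)
  have hyo : y ∈ Ioo (0 : ℝ) 1 := by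
    refine ⟨lt_of_le_of_ne hy.1 ?_, lt_of_le_of_ne hy.2 ?_⟩
    · rintro rfl; linarith
    · rintro rfl; linarith
  have hloc : IsLocalMax u y := hmax.isLocalMax (Icc_mem_nhds hyo.1 hyo.2)
  have h2 := hloc.deriv_deriv_nonpos hu.continuousAt
  have he := h y hyo
  rw [hloc.deriv_eq_zero] at he
  rw [le_div_iff₀ hγ]
  nlinarith [mul_le_mul_of_nonneg_right (hc y hyo) hp.le,
    mul_nonneg hε.le (neg_nonneg.2 h2)]

/-- Leibniz bound for the product of an analytic coefficient with a function whose derivatives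
grow geometrically. -/
theorem abs_iteratedDeriv_mul_le {g v : ℝ → ℝ} {x A γ B R : ℝ} {n : ℕ}
    (hg : ContDiffAt ℝ n g x) (hv : ContDiffAt ℝ n v x)
    (hA : 0 ≤ A) (hγ : 0 ≤ γ) (hB : 0 ≤ B) (hR : 2 * (n * γ) ≤ R)
    (hgb : ∀ k, |iteratedDeriv k g x| ≤ A * k.factorial * γ ^ k)
    (hvb : ∀ k ≤ n, |iteratedDeriv k v x| ≤ B * R ^ k) :
    |iteratedDeriv n (g * v) x| ≤ 2 * A * B * R ^ n := by
  have hnγ : 0 ≤ n * γ := by positivity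
  have hR0 : 0 ≤ R := by linarith
  rw [iteratedDeriv_mul hg hv]
  calc |∑ i ∈ Finset.range (n + 1),
        (n.choose i : ℝ) * iteratedDeriv i g x * iteratedDeriv (n - i) v x|
      ≤ ∑ i ∈ Finset.range (n + 1), A * B * R ^ n * (1 / 2) ^ i := by
        refine (Finset.abs_sum_le_sum_abs _ _).trans (Finset.sum_le_sum fun i hi => ?_)
        have hin : i ≤ n := Nat.lt_succ_iff.1 (Finset.mem_range.1 hi)
        have hch : (n.choose i : ℝ) * i.factorial ≤ (n : ℝ) ^ i := by
          rw [mul_comm]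
          exact_mod_cast (Nat.descFactorial_eq_factorial_mul_choose n i) ▸
            Nat.descFactorial_le_pow n i
        rw [abs_mul, abs_mul, Nat.abs_cast]
        calc (n.choose i : ℝ) * |iteratedDeriv i g x| * |iteratedDeriv (n - i) v x|
            ≤ (n.choose i : ℝ) * (A * i.factorial * γ ^ i) * (B * R ^ (n - i)) := by
              gcongr
              · exact hgb i
              · exact hvb _ (Nat.sub_le _ _)
          _ = A * B * (((n.choose i : ℝ) * i.factorial) * γ ^ i) * R ^ (n - i) := by ring
          _ ≤ A * B * ((n : ℝ) ^ i * γ ^ i) * R ^ (n - i) := by gcongr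
          _ = A * B * (n * γ) ^ i * R ^ (n - i) := by rw [mul_pow]
          _ ≤ A * B * (R * (1 / 2)) ^ i * R ^ (n - i) := by
              gcongr ?_ * ?_ ^ i * ?_
              linarith
          _ = A * B * (R ^ i * R ^ (n - i)) * (1 / 2) ^ i := by rw [mul_pow]; ring
          _ = A * B * R ^ n * (1 / 2) ^ i := by
              rw [← pow_add, Nat.add_sub_cancel' hin]
    _ ≤ A * B * R ^ n * 2 := by
        rw [← Finset.mul_sum]
        exact mul_le_mul_of_nonneg_left (sum_geometric_two_le _) (by positivity)
    _ = 2 * A * B * R ^ n := by ring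

/-- First-derivative bound, from integrating the equation once. -/
theorem abs_deriv_le_of_bvp {b c f u : ℝ → ℝ} {Cb Cb' Cc Cf ε₁ ε₂ M : ℝ}
    (hb : ContDiff ℝ (⊤ : ℕ∞) b) (hu : ContDiff ℝ (⊤ : ℕ∞) u)
    (hε₁ : 0 < ε₁) (hε₂ : 0 < ε₂) (hε₂' : ε₂ ≤ 1)
    (hbb : ∀ x ∈ Ioo (0 : ℝ) 1, |b x| ≤ Cb) (hbb' : ∀ x ∈ Ioo (0 : ℝ) 1, |deriv b x| ≤ Cb')
    (hcb : ∀ x ∈ Ioo (0 : ℝ) 1, |c x| ≤ Cc) (hfb : ∀ x ∈ Ioo (0 : ℝ) 1, |f x| ≤ Cf)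
    (hub : ∀ x ∈ Ioo (0 : ℝ) 1, |u x| ≤ M)
    (h : ∀ x ∈ Ioo (0 : ℝ) 1,
      -ε₁ * deriv (deriv u) x + ε₂ * b x * deriv u x + c x * u x = f x)
    (h01 : u 0 = u 1) :
    ∀ x ∈ Ioo (0 : ℝ) 1, |deriv u x| ≤ (2 * (Cb * M) + (Cb' * M + Cc * M + Cf)) * ε₁⁻¹ := by
  intro x hx
  obtain ⟨ξ, hξ, hξ0⟩ := exists_deriv_eq_zero zero_lt_one hu.continuous.continuousOn h01
  have hdu : ∀ y, HasDerivAt u (deriv u y) y := fun y =>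
    (hu.differentiable (by simp) y).hasDerivAt
  have hdb : ∀ y, HasDerivAt b (deriv b y) y := fun y =>
    (hb.differentiable (by simp) y).hasDerivAt
  have hddu : ∀ y, HasDerivAt (deriv u) (deriv (deriv u) y) y := fun y => by
    have : ContDiff ℝ (⊤ : ℕ∞) (deriv u) := (contDiff_infty_iff_deriv.1 hu).2
    exact (this.differentiable (by simp) y).hasDerivAt
  have hprod : ∀ {a a' s t : ℝ}, |a| ≤ s → |a'| ≤ t → |a * a'| ≤ s * t := by
    intro a a' s t h1 h2
    rw [abs_mul]
    exact mul_le_mul h1 h2 (abs_nonneg _) ((abs_nonneg _).trans h1)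
  have hsmall : ∀ {a s : ℝ}, |a| ≤ s → |ε₂ * a| ≤ s := by
    intro a s h1
    rw [abs_mul, abs_of_pos hε₂]
    exact (mul_le_of_le_one_left (abs_nonneg _) hε₂').trans h1
  set L := Cb' * M + Cc * M + Cf with hL
  have hmv := (convex_Ioo (0 : ℝ) 1).norm_image_sub_le_of_norm_hasDerivWithin_le
    (f := fun y => ε₁ * deriv u y - ε₂ * (b y * u y))
    (f' := fun y => ε₁ * deriv (deriv u) y - ε₂ * (deriv b y * u y + b y * deriv u y))
    (C := L)
    (fun y _ => (((hddu y).const_mul ε₁).sub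
      (((hdb y).mul (hdu y)).const_mul ε₂)).hasDerivWithinAt)
    (fun y hy => by
      have e : ε₁ * deriv (deriv u) y - ε₂ * (deriv b y * u y + b y * deriv u y)
          = c y * u y - f y - ε₂ * (deriv b y * u y) := by linarith [h y hy]
      rw [e, Real.norm_eq_abs]
      have h1 := abs_le.1 (hprod (hcb y hy) (hub y hy))
      have h2 := abs_le.1 (hsmall (hprod (hbb' y hy) (hub y hy)))
      have h3 := abs_le.1 (hfb y hy)
      rw [abs_le]
      constructor <;> linarith) hξ hx
  have hL0 : 0 ≤ L := by
    have := (abs_nonneg _).trans (hprod (hcb x hx) (hub x hx))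
    have := (abs_nonneg _).trans (hprod (hbb' x hx) (hub x hx))
    have := (abs_nonneg _).trans (hfb x hx)
    linarith
  have hxξ : ‖x - ξ‖ ≤ 1 := by
    rw [Real.norm_eq_abs, abs_le]
    constructor <;> linarith [hx.1, hx.2, hξ.1, hξ.2]
  have hmv' := hmv.trans (mul_le_of_le_one_right hL0 hxξ)
  rw [hξ0, Real.norm_eq_abs] at hmv'
  have h1 := abs_le.1 hmv'
  have h2 := abs_le.1 (hsmall (hprod (hbb x hx) (hub x hx)))
  have h3 := abs_le.1 (hsmall (hprod (hbb ξ hξ) (hub ξ hξ)))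
  rw [← div_eq_mul_inv, le_div_iff₀ hε₁, ← abs_of_pos hε₁, ← abs_mul, abs_le]
  constructor <;> linarith

/-- Differentiating the equation `n` times bounds `u⁽ⁿ⁺²⁾` by the lower derivatives. -/
theorem abs_iteratedDeriv_add_two_le_of_bvp {b c f u : ℝ → ℝ}
    {Cb Cc Cf γb γc γf ε₁ ε₂ K C M x : ℝ} {n : ℕ}
    (hb : ContDiff ℝ (⊤ : ℕ∞) b) (hc : ContDiff ℝ (⊤ : ℕ∞) c) (hu : ContDiff ℝ (⊤ : ℕ∞) u)
    (hCb : 0 ≤ Cb) (hCc : 0 ≤ Cc) (hCf : 0 ≤ Cf)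
    (hγb : 0 ≤ γb) (hγc : 0 ≤ γc) (hγf : 0 ≤ γf)
    (hbder : ∀ n : ℕ, |iteratedDeriv n b x| ≤ Cb * n.factorial * γb ^ n)
    (hcder : ∀ n : ℕ, |iteratedDeriv n c x| ≤ Cc * n.factorial * γc ^ n)
    (hfder : ∀ n : ℕ, |iteratedDeriv n f x| ≤ Cf * n.factorial * γf ^ n)
    (hε₁ : 0 < ε₁) (hε₂ : 0 < ε₂) (hε₂' : ε₂ ≤ 1)
    (h : ∀ᶠ y in nhds x,
      -ε₁ * deriv (deriv u) y + ε₂ * b y * deriv u y + c y * u y = f y)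
    (hK : 2 * Cb + 2 * Cc + 1 ≤ K) (hKb : 2 * γb ≤ K) (hKc : 2 * γc ≤ K) (hKf : γf ≤ K)
    (hC : Cf ≤ C) (hM1 : 1 ≤ M) (hMn : n ≤ M) (hMε : ε₁⁻¹ ≤ M)
    (hlow : ∀ m < n + 2, |iteratedDeriv m u x| ≤ C * (K * M) ^ m) :
    |iteratedDeriv (n + 2) u x| ≤ C * (K * M) ^ (n + 2) := by
  have hK1 : 1 ≤ K := by linarith
  have hC0 : 0 ≤ C := hCf.trans hC
  have hR1 : 1 ≤ K * M := one_le_mul_of_one_le_of_one_le hK1 hM1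
  have hKM : ∀ {t : ℝ}, t ≤ K → n * t ≤ K * M := fun ht => by
    rw [mul_comm K]
    exact (mul_le_mul_of_nonneg_left ht (Nat.cast_nonneg n)).trans
      (mul_le_mul_of_nonneg_right hMn (by linarith))
  set R := K * M with hR
  have hu' : ContDiff ℝ (⊤ : ℕ∞) (deriv u) := (contDiff_infty_iff_deriv.1 hu).2
  have hu'' : ContDiff ℝ (⊤ : ℕ∞) (deriv (deriv u)) := (contDiff_infty_iff_deriv.1 hu').2
  have hat : ∀ {w : ℝ → ℝ}, ContDiff ℝ (⊤ : ℕ∞) w → ContDiffAt ℝ n w x := fun hw =>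
    (hw.of_le (by exact_mod_cast le_top)).contDiffAt
  have hf_eq : iteratedDeriv n f x = -ε₁ * iteratedDeriv (n + 2) u x
      + ε₂ * iteratedDeriv n (b * deriv u) x + iteratedDeriv n (c * u) x := by
    have e : f =ᶠ[nhds x]
        ((-ε₁) • deriv (deriv u) + ε₂ • (b * deriv u)) + c * u := by
      filter_upwards [h] with y hy
      simp only [Pi.add_apply, Pi.smul_apply, Pi.mul_apply, smul_eq_mul]
      linarith
    rw [e.iteratedDeriv_eq, iteratedDeriv_add, iteratedDeriv_add,
      iteratedDeriv_const_smul_field, iteratedDeriv_const_smul_field,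
      iteratedDeriv_succ', iteratedDeriv_succ']
    · rfl
    · exact hat (contDiff_const.smul hu'')
    · exact hat (contDiff_const.smul (hb.mul hu'))
    · exact hat ((contDiff_const.smul hu'').add (contDiff_const.smul (hb.mul hu')))
    · exact hat (hc.mul hu)
  have hB : |iteratedDeriv n (b * deriv u) x| ≤ 2 * Cb * (C * R) * R ^ n := by
    refine abs_iteratedDeriv_mul_le (hat hb) (hat hu') hCb hγb (by positivity) ?_ hbder ?_
    · linarith [hKM hKb]
    · intro k hk
      rw [← iteratedDeriv_succ']
      refine (hlow (k + 1) (by lia)).trans (le_of_eq (by ring))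
  have hCu : |iteratedDeriv n (c * u) x| ≤ 2 * Cc * C * R ^ n := by
    refine abs_iteratedDeriv_mul_le (hat hc) (hat hu) hCc hγc hC0 ?_ hcder ?_
    · linarith [hKM hKc]
    · exact fun k hk => hlow k (by lia)
  have hF : |iteratedDeriv n f x| ≤ C * R ^ n := by
    have hfac : (n.factorial : ℝ) ≤ (n : ℝ) ^ n := by exact_mod_cast Nat.factorial_le_pow n
    calc |iteratedDeriv n f x| ≤ Cf * n.factorial * γf ^ n := hfder n
      _ ≤ C * (n : ℝ) ^ n * γf ^ n := by gcongr
      _ = C * (n * γf) ^ n := by rw [mul_pow]; ring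
      _ ≤ C * R ^ n := by
        gcongr
        exact hKM hKf
  have hB' : |ε₂ * iteratedDeriv n (b * deriv u) x| ≤ 2 * Cb * (C * R) * R ^ n := by
    rw [abs_mul, abs_of_pos hε₂]
    exact (mul_le_of_le_one_left (abs_nonneg _) hε₂').trans hB
  have hRn : C * R ^ n ≤ C * R ^ (n + 1) := by gcongr; lia
  have hmain : ε₁ * |iteratedDeriv (n + 2) u x| ≤ K * (C * R ^ (n + 1)) := by
    calc ε₁ * |iteratedDeriv (n + 2) u x| = |ε₁ * iteratedDeriv (n + 2) u x| := by
          rw [abs_mul, abs_of_pos hε₁]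
      _ ≤ 2 * Cb * (C * R) * R ^ n + 2 * Cc * C * R ^ n + C * R ^ n := by
          have h1 := abs_le.1 hB'
          have h2 := abs_le.1 hCu
          have h3 := abs_le.1 hF
          rw [abs_le]
          constructor <;> linarith
      _ = 2 * Cb * (C * R ^ (n + 1)) + (2 * Cc + 1) * (C * R ^ n) := by ring
      _ ≤ 2 * Cb * (C * R ^ (n + 1)) + (2 * Cc + 1) * (C * R ^ (n + 1)) := by gcongr
      _ = (2 * Cb + 2 * Cc + 1) * (C * R ^ (n + 1)) := by ring
      _ ≤ K * (C * R ^ (n + 1)) := by gcongr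
  calc |iteratedDeriv (n + 2) u x| = ε₁⁻¹ * (ε₁ * |iteratedDeriv (n + 2) u x|) := by
        field_simp
    _ ≤ M * (K * (C * R ^ (n + 1))) := by gcongr
    _ = C * R ^ (n + 2) := by rw [hR]; ring

/-- Classical derivative bounds for the solution of the two-parameter
singularly perturbed BVP `-ε₁ u'' + ε₂ b u' + c u = f` on `(0,1)` with `u(0)=u(1)=0`:
there exist constants `K, C > 0`, independent of `ε₁, ε₂` and `u`, such that
`‖u⁽ⁿ⁾‖_{∞,(0,1)} ≤ C Kⁿ (max{n, ε₁⁻¹, ε₂⁻¹})ⁿ` for all `n ∈ ℕ₀`. -/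
theorem derivative_bounds_two_parameter_bvp
    (b c f : ℝ → ℝ)
    (hb : ContDiff ℝ (⊤ : ℕ∞) b) (hc : ContDiff ℝ (⊤ : ℕ∞) c) (hf : ContDiff ℝ (⊤ : ℕ∞) f)
    (Cb Cc Cf γb γc γf : ℝ)
    (hCb : 0 < Cb) (hCc : 0 < Cc) (hCf : 0 < Cf)
    (hγb : 0 < γb) (hγc : 0 < γc) (hγf : 0 < γf)
    (hbder : ∀ n : ℕ, ∀ x ∈ Ioo (0:ℝ) 1,
      |iteratedDeriv n b x| ≤ Cb * (n.factorial : ℝ) * γb ^ n)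
    (hcder : ∀ n : ℕ, ∀ x ∈ Ioo (0:ℝ) 1,
      |iteratedDeriv n c x| ≤ Cc * (n.factorial : ℝ) * γc ^ n)
    (hfder : ∀ n : ℕ, ∀ x ∈ Ioo (0:ℝ) 1,
      |iteratedDeriv n f x| ≤ Cf * (n.factorial : ℝ) * γf ^ n)
    (β γ ρ : ℝ) (hβ : 0 < β) (hγ : 0 < γ) (hρ : 0 < ρ)
    (hblow : ∀ x ∈ Icc (0:ℝ) 1, β ≤ b x)
    (hclow : ∀ x ∈ Icc (0:ℝ) 1, γ ≤ c x) :
    ∃ K C : ℝ, 0 < K ∧ 0 < C ∧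
      ∀ ε₁ ε₂ : ℝ, 0 < ε₁ → ε₁ ≤ 1 → 0 < ε₂ → ε₂ ≤ 1 →
      (∀ x ∈ Icc (0:ℝ) 1, ρ ≤ c x - ε₂ / 2 * deriv b x) →
      ∀ u : ℝ → ℝ, ContDiff ℝ (⊤ : ℕ∞) u →
      (∀ x ∈ Ioo (0:ℝ) 1,
        -ε₁ * iteratedDeriv 2 u x + ε₂ * b x * deriv u x + c x * u x = f x) →
      u 0 = 0 → u 1 = 0 →
      ∀ n : ℕ, ∀ x ∈ Ioo (0:ℝ) 1,
        |iteratedDeriv n u x| ≤ C * K ^ n * (max (max (n : ℝ) ε₁⁻¹) ε₂⁻¹) ^ n := by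
  set M₀ := Cf / γ with hM₀
  set D := 2 * (Cb * M₀) + (Cb * γb * M₀ + Cc * M₀ + Cf) with hD
  set K := 2 * Cb + 2 * Cc + 1 + 2 * γb + 2 * γc + γf with hK
  set C := M₀ + Cf + D with hC
  have hM₀pos : 0 < M₀ := by positivity
  have hDpos : 0 < D := by positivity
  have hCpos : 0 < C := by positivity
  have hK1 : 1 ≤ K := by linarith
  refine ⟨K, C, by linarith, hCpos, ?_⟩
  intro ε₁ ε₂ hε₁ hε₁' hε₂ hε₂' _ u hu heq hu0 hu1
  have h2 : ∀ w : ℝ → ℝ, iteratedDeriv 2 w = deriv (deriv w) := fun w => by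
    rw [iteratedDeriv_succ', iteratedDeriv_one]
  simp only [h2] at heq
  have hbb : ∀ x ∈ Ioo (0:ℝ) 1, |b x| ≤ Cb := fun x hx => by simpa using hbder 0 x hx
  have hbb' : ∀ x ∈ Ioo (0:ℝ) 1, |deriv b x| ≤ Cb * γb := fun x hx => by
    simpa using hbder 1 x hx
  have hcb : ∀ x ∈ Ioo (0:ℝ) 1, |c x| ≤ Cc := fun x hx => by simpa using hcder 0 x hx
  have hfb : ∀ x ∈ Ioo (0:ℝ) 1, |f x| ≤ Cf := fun x hx => by simpa using hfder 0 x hx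
  have hclow' : ∀ x ∈ Ioo (0:ℝ) 1, γ ≤ c x := fun x hx => hclow x (Ioo_subset_Icc_self hx)
  have hub : ∀ x ∈ Ioo (0:ℝ) 1, |u x| ≤ M₀ := by
    intro x hx
    rw [abs_le']
    constructor
    · exact le_div_of_elliptic_le (p := fun y => ε₂ * b y) hu.continuous hε₁ hγ hCf.le hclow'
        (fun y hy => (heq y hy).trans_le (abs_le.1 (hfb y hy)).2) hu0 hu1 x
        (Ioo_subset_Icc_self hx)
    · refine le_div_of_elliptic_le (u := fun y => -u y) (p := fun y => ε₂ * b y)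
        hu.continuous.neg hε₁ hγ hCf.le hclow' (fun y hy => ?_) (by simp [hu0]) (by simp [hu1]) x
        (Ioo_subset_Icc_self hx)
      have hd : deriv (fun y => -u y) = fun y => -deriv u y := by
        funext z
        exact deriv.fun_neg
      rw [hd, deriv.fun_neg]
      linarith [heq y hy, (abs_le.1 (hfb y hy)).1]
  have hub' := abs_deriv_le_of_bvp hb hu hε₁ hε₂ hε₂' hbb hbb' hcb hfb hub heq
    (hu0.trans hu1.symm)
  have hinv : 1 ≤ ε₁⁻¹ := (one_le_inv₀ hε₁).2 hε₁'
  intro n x hx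
  induction n using Nat.strong_induction_on with
  | _ n ih =>
    match n, ih with
    | 0, _ =>
      simpa using (hub x hx).trans (by linarith : M₀ ≤ C)
    | 1, _ =>
      rw [iteratedDeriv_one, pow_one, pow_one]
      refine (hub' x hx).trans ?_
      have hle : ε₁⁻¹ ≤ max (max ((1 : ℕ) : ℝ) ε₁⁻¹) ε₂⁻¹ :=
        (le_max_right _ _).trans (le_max_left _ _)
      refine mul_le_mul ?_ hle (by positivity) (by positivity)
      exact (by linarith : D ≤ C).trans (le_mul_of_one_le_right hCpos.le hK1)
    | n + 2, ih =>
      set M := max (max ((n + 2 : ℕ) : ℝ) ε₁⁻¹) ε₂⁻¹ with hM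
      have hMε : ε₁⁻¹ ≤ M := (le_max_right _ _).trans (le_max_left _ _)
      have hMn : ((n + 2 : ℕ) : ℝ) ≤ M := (le_max_left _ _).trans (le_max_left _ _)
      rw [mul_assoc, ← mul_pow]
      refine abs_iteratedDeriv_add_two_le_of_bvp hb hc hu hCb.le hCc.le hCf.le hγb.le hγc.le
        hγf.le (fun k => hbder k x hx) (fun k => hcder k x hx) (fun k => hfder k x hx)
        hε₁ hε₂ hε₂' ?_ (by linarith) (by linarith) (by linarith) (by linarith) (by linarith)
        (hinv.trans hMε) (by push_cast at hMn; linarith) hMε ?_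
      · filter_upwards [Ioo_mem_nhds hx.1 hx.2] with y hy using heq y hy
      · intro m hm
        refine (ih m hm).trans ?_
        rw [mul_assoc, ← mul_pow]
        gcongr
        rw [hM]
        gcongr
end

section
/- For every t ∈ (0,1], there exists a constant C > 0 (depending only on t) such that for every positive integer q: Γ(q − t q + 1) / Γ(q + t q + 1) ≤ C · ( (1−t)^{(1−t)} / (1+t)^{(1+t)} )^q · q^{−2tq} · e^{2tq}, where Γ is the Gamma function and, for t = 1, the convention 0⁰ = 1 is used. -/
open Real in
lemma differentiableAt_log_Gamma {x : ℝ} (hx : 0 < x) : DifferentiableAt ℝ (log ∘ Gamma) x :=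
  (differentiableAt_log (Gamma_pos_of_pos hx).ne').comp _
    (differentiableOn_Gamma_Ioi.differentiableAt (Ioi_mem_nhds hx))

open Real Set in
/-- The digamma lower bound `log x ≤ ψ(x + 1)`, from log-convexity of `Γ`. -/
lemma log_le_deriv_log_Gamma_add_one {x : ℝ} (hx : 0 < x) :
    log x ≤ deriv (log ∘ Gamma) (x + 1) := by
  have hd := differentiableAt_log_Gamma (by linarith : 0 < x + 1)
  have h := convexOn_log_Gamma.slope_le_deriv (x := x) (y := x + 1) hx
    (by simp only [mem_Ioi]; linarith) (by linarith) hd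
  rw [slope_def_field] at h
  simpa [Gamma_add_one hx.ne', log_mul hx.ne' (Gamma_pos_of_pos hx).ne'] using h

open Real Set in
/-- The function `log (Γ(x + 1) e^x / x^x)` is monotone on `[0, ∞)`. -/
lemma monotoneOn_log_Gamma_add_one_sub :
    MonotoneOn (fun x : ℝ => (log ∘ Gamma) (x + 1) - (x * log x - x)) (Ici 0) := by
  have hd : ∀ x : ℝ, 0 ≤ x → DifferentiableAt ℝ (log ∘ Gamma) (x + 1) := fun x hx =>
    differentiableAt_log_Gamma (by linarith)
  have hderiv : ∀ x : ℝ, 0 < x →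
      HasDerivAt (fun x : ℝ => (log ∘ Gamma) (x + 1) - (x * log x - x))
        (deriv (log ∘ Gamma) (x + 1) - (log x + 1 - 1)) x := fun x hx =>
    ((hd x hx.le).hasDerivAt.comp_add_const x 1).sub
      ((hasDerivAt_mul_log hx.ne').sub (hasDerivAt_id x))
  refine monotoneOn_of_deriv_nonneg (convex_Ici 0) ?_ ?_ ?_
  · refine ContinuousOn.sub (fun x hx => ?_) (continuous_mul_log.sub continuous_id).continuousOn
    exact (ContinuousAt.comp (f := fun x : ℝ => x + 1) (hd x hx).continuousAt
      (by fun_prop)).continuousWithinAt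
  · intro x hx
    rw [interior_Ici] at hx
    exact (hderiv x hx).differentiableAt.differentiableWithinAt
  · intro x hx
    rw [interior_Ici] at hx
    rw [(hderiv x hx).deriv]
    linarith [log_le_deriv_log_Gamma_add_one hx]

open Real in
lemma rpow_self_eq_exp_mul_log {x : ℝ} (hx : 0 ≤ x) : x ^ x = exp (x * log x) := by
  rcases hx.eq_or_lt with rfl | hx
  · simp
  · rw [rpow_def_of_pos hx, mul_comm]

open Real in
lemma Gamma_add_one_div_le {a b : ℝ} (ha : 0 ≤ a) (hab : a ≤ b) :
    Gamma (a + 1) / Gamma (b + 1) ≤ a ^ a / b ^ b * exp (b - a) := by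
  have hb := ha.trans hab
  have h := monotoneOn_log_Gamma_add_one_sub ha hb hab
  simp only [Function.comp_apply] at h
  rw [rpow_self_eq_exp_mul_log ha, rpow_self_eq_exp_mul_log hb,
    ← exp_log (Gamma_pos_of_pos (by linarith : 0 < a + 1)),
    ← exp_log (Gamma_pos_of_pos (by linarith : 0 < b + 1)), ← exp_sub, ← exp_sub, ← exp_add,
    exp_le_exp]
  linarith

open Real in
lemma mul_natCast_rpow_self {s : ℝ} (hs : 0 ≤ s) (q : ℕ) :
    (s * q) ^ (s * q) = (s ^ s) ^ q * (q : ℝ) ^ (s * q) := by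
  rw [mul_rpow hs q.cast_nonneg, rpow_mul hs, rpow_natCast]

/-- Stirling-type estimate for ratios of Gamma functions: for every
`t ∈ (0,1]` there is `C > 0` (depending only on `t`) such that for every positive
integer `q`,
`Γ(q - tq + 1)/Γ(q + tq + 1) ≤ C ((1-t)^{1-t}/(1+t)^{1+t})^q q^{-2tq} e^{2tq}`,
where real powers are `rpow` (so `0^0 = 1`, covering `t = 1`). -/
theorem gamma_ratio_stirling_bound
    (t : ℝ) (ht0 : 0 < t) (ht1 : t ≤ 1) :
    ∃ C : ℝ, 0 < C ∧
      ∀ q : ℕ, 1 ≤ q →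
        Real.Gamma ((q:ℝ) - t * q + 1) / Real.Gamma ((q:ℝ) + t * q + 1)
          ≤ C * (((1 - t) ^ (1 - t) : ℝ) / ((1 + t) ^ (1 + t) : ℝ)) ^ q
              * (q:ℝ) ^ (-(2 * t * (q:ℝ))) * Real.exp (2 * t * q) := by
  refine ⟨1, one_pos, fun q hq => ?_⟩
  have hq0 : (0 : ℝ) < q := by exact_mod_cast hq
  have h := Gamma_add_one_div_le (a := (1 - t) * q) (b := (1 + t) * q)
    (mul_nonneg (by linarith) hq0.le) (mul_le_mul_of_nonneg_right (by linarith) hq0.le)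
  rw [mul_natCast_rpow_self (by linarith), mul_natCast_rpow_self (by linarith),
    mul_div_mul_comm, ← div_pow, ← Real.rpow_sub hq0] at h
  rw [one_mul]
  convert h using 4 <;> ring_nf
end

section
/- Let ε ∈ (0,1], K ≥ 1, C₀ > 0, and let g be a C^∞ function on [0,1] satisfying ‖g⁽ⁿ⁾‖_{0,(0,1)} ≤ C₀ Kⁿ (max{n, ε⁻¹})ⁿ for all n ∈ ℕ₀. Set λ = 1/(eK) and let κ ∈ (0, λ/2]. Then there exist constants C > 0 and β₁ > 0, depending only on C₀ and K (independent of ε and p), such that for every p ∈ ℕ with κ p ε ≥ 1/2 there is a polynomial q of degree at most p with q(0) = g(0), q(1) = g(1), ‖g − q‖²_{0,(0,1)} ≤ C e^{−β₁ p}, and ‖(g − q)'‖²_{0,(0,1)} ≤ C p² e^{−β₁ p}. -/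
open Set

namespace SpectralApproximation

open Polynomial MeasureTheory

/-- The integral of a polynomial over the unit interval, as a linear functional. -/
noncomputable def unitIntegral : ℝ[X] →ₗ[ℝ] ℝ where
  toFun F := ∫ x in (0:ℝ)..1, F.eval x
  map_add' F G := by
    simp only [eval_add]
    exact intervalIntegral.integral_add (F.continuous.intervalIntegrable _ _)
      (G.continuous.intervalIntegrable _ _)
  map_smul' c F := by simp

lemma unitIntegral_apply (F : ℝ[X]) : unitIntegral F = ∫ x in (0:ℝ)..1, F.eval x := rfl

lemma unitIntegral_derivative (F : ℝ[X]) :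
    unitIntegral (derivative F) = F.eval 1 - F.eval 0 :=
  intervalIntegral.integral_eq_sub_of_hasDerivAt (fun x _ => F.hasDerivAt x)
    ((derivative F).continuous.intervalIntegrable _ _)

lemma unitIntegral_mono {F G : ℝ[X]} (h : ∀ x ∈ Icc (0:ℝ) 1, F.eval x ≤ G.eval x) :
    unitIntegral F ≤ unitIntegral G :=
  intervalIntegral.integral_mono_on zero_le_one (F.continuous.intervalIntegrable _ _)
    (G.continuous.intervalIntegrable _ _) h

lemma unitIntegral_mul_self_nonneg (F : ℝ[X]) : 0 ≤ unitIntegral (F * F) :=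
  intervalIntegral.integral_nonneg zero_le_one fun x _ => by
    rw [eval_mul]; exact mul_self_nonneg _

lemma eq_zero_of_unitIntegral_mul_self_eq_zero {F : ℝ[X]} (h : unitIntegral (F * F) = 0) :
    F = 0 := by
  by_contra hF
  have hfin : (F.rootSet ℝ).Finite := F.rootSet_finite ℝ
  obtain ⟨x, hx, hx0⟩ := ((Ioo_infinite (zero_lt_one (α := ℝ))).sdiff hfin).nonempty
  have hne : F.eval x ≠ 0 := fun h0 => hx0 <| by
    rw [mem_rootSet]; exact ⟨hF, by simpa using h0⟩
  have hpos : 0 < ∫ y in (0:ℝ)..1, (F * F).eval y := by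
    refine intervalIntegral.integral_pos zero_lt_one (F * F).continuous.continuousOn
      (fun y _ => ?_) ⟨x, Ioo_subset_Icc_self hx, ?_⟩
    · rw [eval_mul]; exact mul_self_nonneg _
    · rw [eval_mul]; exact mul_self_pos.2 hne
  rw [unitIntegral_apply] at h
  exact hpos.ne' h

/-- In each degree there is a polynomial orthogonal to all polynomials of lower degree. -/
lemma exists_orthogonal (n : ℕ) :
    ∃ φ : ℝ[X], φ.natDegree ≤ n ∧ φ.coeff n ≠ 0 ∧
      ∀ G : ℝ[X], G.degree < n → unitIntegral (φ * G) = 0 := by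
  let T : degreeLT ℝ (n + 1) →ₗ[ℝ] (Fin n → ℝ) := LinearMap.pi fun i =>
    unitIntegral ∘ₗ LinearMap.mulRight ℝ (X ^ (i : ℕ)) ∘ₗ (degreeLT ℝ (n + 1)).subtype
  have : FiniteDimensional ℝ (degreeLT ℝ (n + 1)) :=
    (degreeLTEquiv ℝ (n + 1)).symm.finiteDimensional
  have hT : LinearMap.ker T ≠ ⊥ := T.ker_ne_bot_of_finrank_lt <| by
    rw [(degreeLTEquiv ℝ (n + 1)).finrank_eq]; simp
  obtain ⟨⟨φ, hφ⟩, hker, hne⟩ := (Submodule.ne_bot_iff _).mp hT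
  have horth : ∀ G : ℝ[X], G.degree < n → unitIntegral (φ * G) = 0 := by
    intro G hG
    rcases eq_or_ne G 0 with rfl | hG0
    · simp
    rw [G.as_sum_range' n ((natDegree_lt_iff_degree_lt hG0).2 hG), Finset.mul_sum, map_sum]
    refine Finset.sum_eq_zero fun i hi => ?_
    have := congrFun (LinearMap.mem_ker.1 hker) ⟨i, Finset.mem_range.1 hi⟩
    replace this : unitIntegral (φ * X ^ i) = 0 := this
    rw [← smul_X_eq_monomial, mul_smul_comm, map_smul, this, smul_zero]
  have hφ0 : φ ≠ 0 := fun h => hne (Subtype.ext h)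
  have hdeg : φ.natDegree < n + 1 := (natDegree_lt_iff_degree_lt hφ0).2 (mem_degreeLT.1 hφ)
  refine ⟨φ, Nat.lt_succ_iff.1 hdeg, fun h => hφ0 ?_, horth⟩
  refine eq_zero_of_unitIntegral_mul_self_eq_zero (horth φ ?_)
  rw [degree_lt_iff_coeff_zero]
  intro m hm
  rcases hm.eq_or_lt with rfl | hm
  · exact h
  · exact coeff_eq_zero_of_natDegree_lt (by omega)

/-- The Legendre operator acts on the leading coefficient as multiplication by `n (n + 1)`. -/
lemma degree_legendre_sub_lt (n : ℕ) (G : ℝ[X]) (hG : G.natDegree ≤ n) :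
    (derivative (X * (1 - X) * derivative G) + ((n:ℝ) * (n + 1)) • G).degree < (n : WithBot ℕ) := by
  rw [degree_lt_iff_coeff_zero]
  intro m hm
  have h1 : X * (1 - X) * derivative G = X * derivative G - X * (X * derivative G) := by ring
  have h2 : G.coeff (m + 1) = 0 := coeff_eq_zero_of_natDegree_lt (by omega)
  rw [h1]
  rcases m with _ | m
  · simp only [nonpos_iff_eq_zero] at hm
    simp [coeff_derivative, hm, h2]
  · simp only [coeff_add, coeff_derivative, coeff_sub, coeff_X_mul, coeff_smul, smul_eq_mul, h2]
    rcases hm.eq_or_lt with rfl | hm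
    · push_cast; ring
    · rw [coeff_eq_zero_of_natDegree_lt (by omega : G.natDegree < m + 1)]; ring

lemma unitIntegral_weighted_derivative (F G : ℝ[X]) :
    unitIntegral (X * (1 - X) * (derivative F * derivative G)) =
      - unitIntegral (F * derivative (X * (1 - X) * derivative G)) := by
  have h := unitIntegral_derivative (F * (X * (1 - X) * derivative G))
  rw [derivative_mul, map_add] at h
  simp only [eval_mul, eval_X, eval_sub, eval_one, sub_self, mul_zero, zero_mul] at h
  rw [show X * (1 - X) * (derivative F * derivative G)
    = derivative F * (X * (1 - X) * derivative G) by ring]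
  linarith

/-- Weighted best approximation estimate for polynomials, from the Legendre expansion. -/
lemma exists_approx_weighted (p k : ℕ) (F : ℝ[X]) (hF : F.natDegree ≤ p + k) :
    ∃ q : ℝ[X], q.natDegree ≤ p ∧
      ((p:ℝ) + 1) ^ 2 * unitIntegral ((F - q) * (F - q)) ≤
        unitIntegral (X * (1 - X) * (derivative F * derivative F)) := by
  induction k generalizing F with
  | zero =>
    refine ⟨F, hF, ?_⟩
    simp only [sub_self, mul_zero, map_zero]
    refine (map_zero unitIntegral).symm.le.trans (unitIntegral_mono fun x hx => ?_)
    simp only [eval_zero, eval_mul, eval_X, eval_sub, eval_one]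
    exact mul_nonneg (mul_nonneg hx.1 (sub_nonneg.2 hx.2)) (mul_self_nonneg _)
  | succ k ih =>
    obtain ⟨φ, hφ, hφn, horth⟩ := exists_orthogonal (p + (k + 1))
    set n := p + (k + 1) with hn
    obtain ⟨a, F₁, hF₁, rfl⟩ : ∃ (a : ℝ) (F₁ : ℝ[X]), F₁.natDegree ≤ p + k ∧ F = F₁ + a • φ := by
      refine ⟨F.coeff n / φ.coeff n, F - (F.coeff n / φ.coeff n) • φ, ?_, by simp⟩
      rw [natDegree_le_iff_coeff_eq_zero]
      intro m hm
      rcases (show n ≤ m by omega).eq_or_lt with rfl | hm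
      · simp [hφn]
      · simp [coeff_eq_zero_of_natDegree_lt (hF.trans_lt hm),
          coeff_eq_zero_of_natDegree_lt (hφ.trans_lt hm)]
    obtain ⟨q, hq, hle⟩ := ih F₁ hF₁
    refine ⟨q, hq, ?_⟩
    have hlow : ∀ G : ℝ[X], G.natDegree ≤ p + k → unitIntegral (φ * G) = 0 := fun G hG =>
      horth G <| degree_le_natDegree.trans_lt <| by exact_mod_cast (by omega : G.natDegree < n)
    have hD : ∀ G : ℝ[X], G.natDegree ≤ n →
        unitIntegral (X * (1 - X) * (derivative φ * derivative G)) =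
          (n:ℝ) * (n + 1) * unitIntegral (φ * G) := by
      intro G hG
      have := horth _ (degree_legendre_sub_lt n G hG)
      rw [mul_add, map_add, mul_smul_comm, map_smul, smul_eq_mul] at this
      rw [unitIntegral_weighted_derivative]
      linarith
    have e1 : (F₁ + a • φ - q) * (F₁ + a • φ - q) =
        (F₁ - q) * (F₁ - q) + (2 * a) • (φ * (F₁ - q)) + (a ^ 2) • (φ * φ) := by
      simp only [smul_eq_C_mul, map_mul, map_pow, map_ofNat]; ring
    have e2 : X * (1 - X) * (derivative (F₁ + a • φ) * derivative (F₁ + a • φ)) =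
        X * (1 - X) * (derivative F₁ * derivative F₁)
        + (2 * a) • (X * (1 - X) * (derivative φ * derivative F₁))
        + (a ^ 2) • (X * (1 - X) * (derivative φ * derivative φ)) := by
      simp only [smul_eq_C_mul, map_mul, map_pow, map_ofNat, derivative_add, derivative_C_mul]
      ring
    rw [e1, e2]
    simp only [map_add, map_smul, smul_eq_mul]
    rw [hD _ (hF₁.trans (by omega)), hD _ hφ, hlow _ hF₁,
      hlow _ ((natDegree_sub_le _ _).trans (max_le hF₁ (hq.trans (by omega))))]
    have hpn : ((p:ℝ) + 1) ^ 2 ≤ (n:ℝ) * (n + 1) := by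
      have : (p:ℝ) + 1 ≤ n := by exact_mod_cast (by omega : p + 1 ≤ n)
      nlinarith [(Nat.cast_nonneg p : (0:ℝ) ≤ p)]
    have := mul_le_mul_of_nonneg_right hpn
      (mul_nonneg (sq_nonneg a) (unitIntegral_mul_self_nonneg φ))
    linarith

lemma exists_approx_polynomial (p : ℕ) (F : ℝ[X]) :
    ∃ q : ℝ[X], q.natDegree ≤ p ∧
      4 * ((p:ℝ) + 1) ^ 2 * (∫ x in (0:ℝ)..1, (F.eval x - q.eval x) ^ 2) ≤
        ∫ x in (0:ℝ)..1, ((derivative F).eval x) ^ 2 := by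
  obtain ⟨q, hq, hle⟩ := exists_approx_weighted p F.natDegree F (by omega)
  refine ⟨q, hq, ?_⟩
  have h1 : unitIntegral (X * (1 - X) * (derivative F * derivative F)) ≤
      unitIntegral ((1 / 4 : ℝ) • (derivative F * derivative F)) := by
    refine unitIntegral_mono fun x _ => ?_
    simp only [eval_smul, eval_mul, eval_X, eval_sub, eval_one, smul_eq_mul]
    exact mul_le_mul_of_nonneg_right (by nlinarith [sq_nonneg (x - 1 / 2)]) (mul_self_nonneg _)
  rw [map_smul, smul_eq_mul] at h1
  simp only [unitIntegral_apply, eval_mul, eval_sub, ← sq, eval_pow] at h1 hle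
  linarith

/-- Every real polynomial has an antiderivative vanishing at `0`. -/
lemma exists_antiderivative (r : ℝ[X]) :
    ∃ R : ℝ[X], derivative R = r ∧ R.eval 0 = 0 ∧ R.natDegree ≤ r.natDegree + 1 := by
  refine ⟨∑ i ∈ Finset.range (r.natDegree + 1), C (r.coeff i / (i + 1)) * X ^ (i + 1), ?_, ?_, ?_⟩
  · conv_rhs => rw [r.as_sum_range_C_mul_X_pow]
    rw [derivative_sum]
    refine Finset.sum_congr rfl fun i _ => ?_
    rw [derivative_C_mul_X_pow]
    have : (i:ℝ) + 1 ≠ 0 := by positivity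
    simp [div_mul_cancel₀ _ this]
  · simp [eval_finsetSum]
  · refine natDegree_sum_le_of_forall_le _ _ fun i hi => ?_
    exact (natDegree_C_mul_X_pow_le _ _).trans (by have := Finset.mem_range.1 hi; omega)

lemma contDiff_eval (F : ℝ[X]) (n : WithTop ℕ∞) : ContDiff ℝ n fun x => F.eval x := by
  simpa using F.contDiff_aeval (R := ℝ) (𝕜 := ℝ) n

lemma sq_integral_le {u : ℝ → ℝ} (hu : Continuous u) {x : ℝ} (hx : x ∈ Icc (0:ℝ) 1) :
    (∫ t in (0:ℝ)..x, u t) ^ 2 ≤ ∫ t in (0:ℝ)..1, u t ^ 2 := by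
  set m := ∫ t in (0:ℝ)..x, u t with hm
  have hii : ∀ {v : ℝ → ℝ}, Continuous v → ∀ a b, IntervalIntegrable v volume a b :=
    fun hv a b => hv.intervalIntegrable a b
  have h0 : 0 ≤ ∫ t in (0:ℝ)..x, (u t - m) ^ 2 :=
    intervalIntegral.integral_nonneg hx.1 fun t _ => sq_nonneg _
  have h1 : ∫ t in (0:ℝ)..x, (u t - m) ^ 2 =
      (∫ t in (0:ℝ)..x, u t ^ 2) - 2 * m * m + x * m ^ 2 := by
    have : ∀ t, (u t - m) ^ 2 = u t ^ 2 - 2 * m * u t + m ^ 2 := fun t => by ring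
    simp only [this]
    rw [intervalIntegral.integral_add (hii (by fun_prop) _ _) (hii (by fun_prop) _ _),
      intervalIntegral.integral_sub (hii (by fun_prop) _ _) (hii (by fun_prop) _ _),
      intervalIntegral.integral_const_mul, intervalIntegral.integral_const, ← hm]
    simp
  have h2 : 0 ≤ ∫ t in x..1, u t ^ 2 :=
    intervalIntegral.integral_nonneg hx.2 fun t _ => sq_nonneg _
  have h3 : (∫ t in (0:ℝ)..x, u t ^ 2) + (∫ t in x..1, u t ^ 2) = ∫ t in (0:ℝ)..1, u t ^ 2 :=
    intervalIntegral.integral_add_adjacent_intervals (hii (by fun_prop) _ _) (hii (by fun_prop) _ _)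
  nlinarith [mul_nonneg (sub_nonneg.2 hx.2) (sq_nonneg m)]

lemma sq_le_integral_sq_deriv {h : ℝ → ℝ} (hh : ContDiff ℝ 1 h) (h0 : h 0 = 0) {x : ℝ}
    (hx : x ∈ Icc (0:ℝ) 1) : h x ^ 2 ≤ ∫ t in (0:ℝ)..1, deriv h t ^ 2 := by
  have hc : Continuous (deriv h) := hh.continuous_deriv le_rfl
  have := sq_integral_le hc hx
  rwa [intervalIntegral.integral_deriv_eq_sub
    (fun t _ => (hh.differentiable one_ne_zero).differentiableAt) (hc.intervalIntegrable _ _),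
    h0, sub_zero] at this

lemma integral_le_of_le_const {u : ℝ → ℝ} (hu : Continuous u) {c : ℝ}
    (h : ∀ x ∈ Icc (0:ℝ) 1, u x ≤ c) : ∫ x in (0:ℝ)..1, u x ≤ c := by
  simpa using intervalIntegral.integral_mono_on zero_le_one (hu.intervalIntegrable _ _)
    (continuous_const.intervalIntegrable (μ := volume) _ _) h

lemma integral_sq_le_two_mul {u v w : ℝ → ℝ} (hv : Continuous v) (hw : Continuous w)
    (huvw : ∀ x, u x = v x + w x) :
    ∫ x in (0:ℝ)..1, u x ^ 2 ≤
      2 * (∫ x in (0:ℝ)..1, v x ^ 2) + 2 * ∫ x in (0:ℝ)..1, w x ^ 2 := by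
  rw [← intervalIntegral.integral_const_mul, ← intervalIntegral.integral_const_mul,
    ← intervalIntegral.integral_add (Continuous.intervalIntegrable (by fun_prop) _ _)
      (Continuous.intervalIntegrable (by fun_prop) _ _)]
  obtain rfl : u = fun x => v x + w x := funext huvw
  refine intervalIntegral.integral_mono_on zero_le_one
    (Continuous.intervalIntegrable (by fun_prop) _ _)
    (Continuous.intervalIntegrable (by fun_prop) _ _) fun x _ => ?_
  nlinarith [sq_nonneg (v x - w x)]

/-- A Jackson type estimate in `L²(0, 1)`. -/
lemma exists_approx_of_integral_sq_deriv_lt {f : ℝ → ℝ} (hf : ContDiff ℝ 1 f) (p : ℕ) {A : ℝ}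
    (hA : ∫ x in (0:ℝ)..1, deriv f x ^ 2 < A) :
    ∃ q : ℝ[X], q.natDegree ≤ p ∧
      ∫ x in (0:ℝ)..1, (f x - q.eval x) ^ 2 < A / ((p:ℝ) + 1) ^ 2 := by
  have hP : 1 ≤ ((p:ℝ) + 1) ^ 2 := one_le_pow₀ (by linarith [(Nat.cast_nonneg p : (0:ℝ) ≤ p)])
  set P := ((p:ℝ) + 1) ^ 2
  set I := ∫ x in (0:ℝ)..1, deriv f x ^ 2
  have hP0 : 0 < P := by linarith
  set δ := (A - I) / (4 * P) with hδ
  have hδ0 : 0 < δ := div_pos (by linarith) (by linarith)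
  have hδP : 4 * (δ * P) = A - I := by rw [hδ]; field_simp
  have hfc : Continuous (deriv f) := hf.continuous_deriv le_rfl
  obtain ⟨r, hr⟩ := exists_polynomial_near_of_continuousOn 0 1 (deriv f) hfc.continuousOn
    (Real.sqrt δ) (Real.sqrt_pos.2 hδ0)
  have hrsq : ∀ x ∈ Icc (0:ℝ) 1, (r.eval x - deriv f x) ^ 2 ≤ δ := fun x hx => by
    rw [← sq_abs, ← Real.sq_sqrt hδ0.le]
    exact pow_le_pow_left₀ (abs_nonneg _) (hr x hx).le 2
  have hrI : ∫ x in (0:ℝ)..1, (r.eval x - deriv f x) ^ 2 ≤ δ :=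
    integral_le_of_le_const ((r.continuous.sub hfc).pow 2) hrsq
  obtain ⟨R, rfl, hR0, -⟩ := exists_antiderivative r
  obtain ⟨q, hq, hle⟩ := exists_approx_polynomial p (R + C (f 0))
  refine ⟨q, hq, ?_⟩
  set F := R + C (f 0) with hF
  have hF' : derivative F = derivative R := by simp [hF]
  rw [hF'] at hle
  have hdF : ∀ x, deriv (fun y => F.eval y - f y) x = (derivative R).eval x - deriv f x := by
    intro x
    rw [← hF']
    exact ((F.hasDerivAt x).sub
      ((hf.differentiable one_ne_zero).differentiableAt.hasDerivAt)).deriv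
  have hFf : ∫ x in (0:ℝ)..1, (F.eval x - f x) ^ 2 ≤ δ := by
    refine integral_le_of_le_const ((F.continuous.sub hf.continuous).pow 2) fun x hx => ?_
    refine (sq_le_integral_sq_deriv (h := fun y => F.eval y - f y) ((contDiff_eval F _).sub hf)
      (by simp [hF, hR0]) hx).trans ?_
    simpa only [hdF] using hrI
  have hr2 := integral_sq_le_two_mul (u := fun x => (derivative R).eval x)
    (derivative R |>.continuous.sub hfc) hfc (fun x => by simp)
  have hf2 := integral_sq_le_two_mul (u := fun x => f x - q.eval x)
    (F.continuous.sub q.continuous) (hf.continuous.sub F.continuous) (fun x => by simp)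
  simp only [Pi.sub_apply, sub_sq_comm (f _) (F.eval _)] at hr2 hf2
  rw [lt_div_iff₀ hP0]
  nlinarith [mul_le_mul_of_nonneg_right hf2 hP0.le, mul_le_mul_of_nonneg_right hFf hP0.le]

/-- Iterated Jackson estimate: approximation order `s` for functions with `s` derivatives. -/
lemma exists_approx_of_integral_sq_iteratedDeriv_lt (m s : ℕ) {f : ℝ → ℝ}
    (hf : ContDiff ℝ (⊤ : ℕ∞) f) {A : ℝ}
    (hA : ∫ x in (0:ℝ)..1, iteratedDeriv s f x ^ 2 < A) :
    ∃ q : ℝ[X], q.natDegree ≤ m + s ∧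
      ∫ x in (0:ℝ)..1, (f x - q.eval x) ^ 2 < A / (((m:ℝ) + 1) ^ 2) ^ s := by
  induction s generalizing f with
  | zero => exact ⟨0, by simp, by simpa using hA⟩
  | succ s ih =>
    rw [iteratedDeriv_succ'] at hA
    obtain ⟨r, hr, hlt⟩ := ih (f := deriv f) (contDiff_infty_iff_deriv.1 hf).2 hA
    obtain ⟨R, rfl, -, hR⟩ := exists_antiderivative r
    have hd : ∀ x, deriv (fun y => f y - R.eval y) x = deriv f x - (derivative R).eval x :=
      fun x => (((hf.differentiable (by simp)).differentiableAt.hasDerivAt).sub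
        (R.hasDerivAt x)).deriv
    obtain ⟨q, hq, hlt'⟩ := exists_approx_of_integral_sq_deriv_lt
      (f := fun y => f y - R.eval y) ((hf.of_le (by exact_mod_cast le_top)).sub (contDiff_eval R _))
      (m + (s + 1)) (by simpa only [hd] using hlt)
    refine ⟨R + q, (natDegree_add_le _ _).trans (max_le (hR.trans (by omega)) hq), ?_⟩
    have hA0 : 0 ≤ A / (((m:ℝ) + 1) ^ 2) ^ s :=
      (intervalIntegral.integral_nonneg zero_le_one fun x _ => sq_nonneg _).trans hlt.le
    simp only [eval_add, ← sub_sub]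
    refine hlt'.trans_le ?_
    rw [pow_succ (((m:ℝ) + 1) ^ 2) s, ← div_div]
    gcongr
    linarith [(Nat.cast_nonneg s : (0:ℝ) ≤ s)]

/-- An approximation of the derivative yields an approximation interpolating at both endpoints. -/
lemma exists_interpolating {g : ℝ → ℝ} (hg : ContDiff ℝ 1 g) {n : ℕ} {E : ℝ} {r : ℝ[X]}
    (hr : r.natDegree ≤ n) (hE : ∫ x in (0:ℝ)..1, (deriv g x - r.eval x) ^ 2 ≤ E) :
    ∃ q : ℝ[X], q.natDegree ≤ n + 1 ∧ q.eval 0 = g 0 ∧ q.eval 1 = g 1 ∧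
      ∫ x in (0:ℝ)..1, (g x - q.eval x) ^ 2 ≤ E ∧
      ∫ x in (0:ℝ)..1, deriv (fun y => g y - q.eval y) x ^ 2 ≤ E := by
  obtain ⟨R, rfl, hR0, hR⟩ := exists_antiderivative r
  have hgc : Continuous (deriv g) := hg.continuous_deriv le_rfl
  set d := g 1 - g 0 - R.eval 1 with hd
  set q := C (g 0) + R + C d * X with hq
  have hder : ∀ x, deriv (fun y => g y - q.eval y) x = deriv g x - (derivative R).eval x - d := by
    intro x
    refine ((hg.differentiable one_ne_zero).differentiableAt.hasDerivAt.sub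
      (q.hasDerivAt x)).deriv.trans ?_
    simp only [hq, derivative_add, derivative_C, derivative_mul, derivative_X, eval_add, eval_mul,
      eval_zero, eval_C, eval_one, eval_X]
    ring
  have hint : ∫ x in (0:ℝ)..1, (deriv g x - (derivative R).eval x) = d := by
    rw [intervalIntegral.integral_sub (hgc.intervalIntegrable _ _)
      ((derivative R).continuous.intervalIntegrable _ _),
      intervalIntegral.integral_deriv_eq_sub
        (fun t _ => (hg.differentiable one_ne_zero).differentiableAt)
        (hgc.intervalIntegrable _ _), ← unitIntegral_apply, unitIntegral_derivative, hR0, hd]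
    ring
  have hE' : ∫ x in (0:ℝ)..1, deriv (fun y => g y - q.eval y) x ^ 2 ≤ E := by
    have : ∀ x, (deriv g x - (derivative R).eval x - d) ^ 2 =
        (deriv g x - (derivative R).eval x) ^ 2 -
          2 * d * (deriv g x - (derivative R).eval x) + d ^ 2 := fun x => by ring
    simp only [hder, this]
    have hc := hgc.sub (derivative R).continuous
    rw [intervalIntegral.integral_add (Continuous.intervalIntegrable (by fun_prop) _ _)
        (Continuous.intervalIntegrable (by fun_prop) _ _),
      intervalIntegral.integral_sub (Continuous.intervalIntegrable (by fun_prop) _ _)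
        (Continuous.intervalIntegrable (by fun_prop) _ _),
      intervalIntegral.integral_const_mul, hint, intervalIntegral.integral_const]
    simp only [sub_zero, smul_eq_mul, one_mul]
    nlinarith [sq_nonneg d]
  have h0 : q.eval 0 = g 0 := by simp [hq, hR0]
  refine ⟨q, ?_, h0, by simp [hq, hd], ?_, hE'⟩
  · refine (natDegree_add_le _ _).trans (max_le ((natDegree_add_le _ _).trans (max_le (by simp)
      (hR.trans (by omega)))) ((natDegree_C_mul_le _ _).trans (by simp)))
  · refine integral_le_of_le_const ((hg.continuous.sub q.continuous).pow 2) fun x hx => ?_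
    exact (sq_le_integral_sq_deriv (h := fun y => g y - q.eval y) (hg.sub (contDiff_eval q _))
      (by simp [h0]) hx).trans hE'

lemma exp_one_le_sub_one_sq : Real.exp 1 ≤ (Real.exp 1 - 1) ^ 2 := by
  nlinarith [Real.exp_one_gt_d9]

lemma sq_mul_exp_neg_le {β : ℝ} (hβ : 0 < β) (p : ℕ) :
    (p:ℝ) ^ 2 * Real.exp (-β * p) ≤ 8 / β ^ 2 * Real.exp (-(β / 2) * p) := by
  have hx : 0 ≤ β / 2 * p := by positivity
  have h := Real.quadratic_le_exp_of_nonneg hx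
  have h1 : (p:ℝ) ^ 2 ≤ 8 / β ^ 2 * Real.exp (β / 2 * p) := by
    rw [div_mul_eq_mul_div, le_div_iff₀ (by positivity)]
    nlinarith
  calc (p:ℝ) ^ 2 * Real.exp (-β * p)
      ≤ 8 / β ^ 2 * Real.exp (β / 2 * p) * Real.exp (-β * p) := by gcongr
    _ = 8 / β ^ 2 * Real.exp (-(β / 2) * p) := by
      rw [mul_assoc, ← Real.exp_add]; ring_nf

/-- Exponentially accurate approximation of `g'` in the asymptotic range. -/
lemma exists_approx_deriv {K C₀ : ℝ} (hK : 1 ≤ K) (hC₀ : 0 < C₀) {B : ℝ} {g : ℝ → ℝ}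
    (hg : ContDiff ℝ (⊤ : ℕ∞) g)
    (hbound : ∀ n : ℕ, Real.sqrt (∫ x in (0:ℝ)..1, iteratedDeriv n g x ^ 2)
      ≤ C₀ * K ^ n * (max (n:ℝ) B) ^ n)
    {p : ℕ} (hB : 1 ≤ B) (hBp : B ≤ p / (Real.exp 1 * K)) :
    ∃ (n : ℕ) (r : ℝ[X]), n + 1 = p ∧ r.natDegree ≤ n ∧
      ∫ x in (0:ℝ)..1, (deriv g x - r.eval x) ^ 2 ≤
        4 * C₀ ^ 2 * Real.exp 2 * ((p:ℝ) ^ 2 * Real.exp (-(1 / (Real.exp 1 * K)) * p)) := by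
  have he : 1 < Real.exp 1 := by linarith [Real.exp_one_gt_d9]
  have he0 : 0 < Real.exp 1 := Real.exp_pos 1
  have hK0 : 0 < K := by linarith
  set M := (p:ℝ) / (Real.exp 1 * K) with hM
  have hM1 : 1 ≤ M := hB.trans hBp
  have hMe : M ≤ p / Real.exp 1 :=
    div_le_div_of_nonneg_left (by positivity) he0 (le_mul_of_one_le_right he0.le hK)
  have hMp : M ≤ p := hMe.trans (div_le_self (by positivity) he.le)
  obtain ⟨s, hs⟩ : ∃ s, ⌊M⌋₊ = s + 1 :=
    ⟨⌊M⌋₊ - 1, by have := (Nat.one_le_floor_iff M).2 hM1; omega⟩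
  have hsM : ((s + 1 : ℕ) : ℝ) ≤ M := hs ▸ Nat.floor_le (by linarith)
  have hMs : M < (s:ℝ) + 2 := by
    have := Nat.lt_floor_add_one M
    rw [hs] at this; push_cast at this; linarith
  obtain ⟨m, hm⟩ : ∃ m, m + s + 1 = p := by
    have : s + 1 ≤ p := by exact_mod_cast hsM.trans hMp
    exact ⟨p - (s + 1), by omega⟩
  have hp0 : (0:ℝ) < p := by linarith
  have hmp : p - p / Real.exp 1 ≤ (m:ℝ) + 1 := by
    have : (m:ℝ) + s + 1 = p := by exact_mod_cast hm
    push_cast at hsM; linarith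
  have hderiv : ∫ x in (0:ℝ)..1, iteratedDeriv (s + 1) g x ^ 2 ≤
      (C₀ * (p / Real.exp 1) ^ (s + 1)) ^ 2 := by
    refine (Real.sqrt_le_left (by positivity)).1 ((hbound (s + 1)).trans ?_)
    have hKM : K * M = p / Real.exp 1 := by rw [hM]; field_simp
    rw [← hKM, mul_pow, ← mul_assoc]
    gcongr
    exact max_le hsM hBp
  have hlt : ∫ x in (0:ℝ)..1, iteratedDeriv s (deriv g) x ^ 2 <
      4 * (C₀ * (p / Real.exp 1) ^ (s + 1)) ^ 2 := by
    rw [iteratedDeriv_succ'] at hderiv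
    have : 0 < (C₀ * ((p:ℝ) / Real.exp 1) ^ (s + 1)) ^ 2 := by positivity
    linarith
  obtain ⟨r, hr, hle⟩ := exists_approx_of_integral_sq_iteratedDeriv_lt m s
    (contDiff_infty_iff_deriv.1 hg).2 hlt
  refine ⟨m + s, r, hm, hr, hle.le.trans ?_⟩
  have hratio : ((p:ℝ) / Real.exp 1) ^ 2 / ((m:ℝ) + 1) ^ 2 ≤ Real.exp (-1) := by
    rw [div_le_iff₀ (by positivity), Real.exp_neg]
    have h1 : (p - p / Real.exp 1) ^ 2 ≤ ((m:ℝ) + 1) ^ 2 :=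
      pow_le_pow_left₀ (sub_nonneg.2 (div_le_self hp0.le he.le)) hmp 2
    calc ((p:ℝ) / Real.exp 1) ^ 2
        = (Real.exp 1)⁻¹ * ((p / Real.exp 1) ^ 2 * Real.exp 1) := by field_simp
      _ ≤ (Real.exp 1)⁻¹ * ((p / Real.exp 1) ^ 2 * (Real.exp 1 - 1) ^ 2) := by
        gcongr; exact exp_one_le_sub_one_sq
      _ = (Real.exp 1)⁻¹ * (p - p / Real.exp 1) ^ 2 := by field_simp
      _ ≤ (Real.exp 1)⁻¹ * ((m:ℝ) + 1) ^ 2 := by gcongr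
  have hexp : Real.exp (-1) ^ s ≤ Real.exp 2 * Real.exp (-(1 / (Real.exp 1 * K)) * p) := by
    rw [← Real.exp_nat_mul, ← Real.exp_add, Real.exp_le_exp,
      show -(1 / (Real.exp 1 * K)) * (p:ℝ) = -M by rw [hM]; ring]
    linarith
  calc 4 * (C₀ * ((p:ℝ) / Real.exp 1) ^ (s + 1)) ^ 2 / (((m:ℝ) + 1) ^ 2) ^ s
      = 4 * C₀ ^ 2 * (p / Real.exp 1) ^ 2 *
          ((p / Real.exp 1) ^ 2 / ((m:ℝ) + 1) ^ 2) ^ s := by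
        rw [div_pow _ (((m:ℝ) + 1) ^ 2), mul_pow, ← pow_mul, ← pow_mul]; ring
    _ ≤ 4 * C₀ ^ 2 * (p:ℝ) ^ 2 * Real.exp (-1) ^ s := by
        gcongr
        exact div_le_self hp0.le he.le
    _ ≤ 4 * C₀ ^ 2 * (p:ℝ) ^ 2 *
          (Real.exp 2 * Real.exp (-(1 / (Real.exp 1 * K)) * p)) := by gcongr
    _ = _ := by ring

lemma setIntegral_Ioo_eq (u : ℝ → ℝ) :
    ∫ x in Ioo (0:ℝ) 1, u x = ∫ x in (0:ℝ)..1, u x := by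
  rw [intervalIntegral.integral_of_le zero_le_one, integral_Ioc_eq_integral_Ioo]

end SpectralApproximation

/-- Exponential approximation in the asymptotic range `κ p ε ≥ 1/2`: for a
smooth `g` with `‖g⁽ⁿ⁾‖₀ ≤ C₀ Kⁿ (max{n, ε⁻¹})ⁿ`, setting `λ = 1/(eK)` and
`κ ∈ (0, λ/2]`, there are constants `C, β₁ > 0` depending only on `C₀, K` such that for
each such `p` there is a polynomial `q` of degree `≤ p` matching `g` at `0, 1` with
`‖g - q‖₀² ≤ C e^{-β₁ p}` and `‖(g - q)'‖₀² ≤ C p² e^{-β₁ p}`. -/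
theorem asymptotic_range_approximation
    (K C₀ : ℝ) (hK : 1 ≤ K) (hC₀ : 0 < C₀) :
    ∃ C β₁ : ℝ, 0 < C ∧ 0 < β₁ ∧
      ∀ ε : ℝ, 0 < ε → ε ≤ 1 →
      ∀ g : ℝ → ℝ, ContDiff ℝ (⊤ : ℕ∞) g →
      (∀ n : ℕ, Real.sqrt (∫ x in Ioo (0:ℝ) 1, (iteratedDeriv n g x)^2)
          ≤ C₀ * K ^ n * (max (n:ℝ) ε⁻¹) ^ n) →
      ∀ κ : ℝ, 0 < κ → κ ≤ (1 / (Real.exp 1 * K)) / 2 →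
      ∀ p : ℕ, 1/2 ≤ κ * p * ε →
      ∃ q : Polynomial ℝ, q.natDegree ≤ p ∧
        Polynomial.eval 0 q = g 0 ∧ Polynomial.eval 1 q = g 1 ∧
        (∫ x in Ioo (0:ℝ) 1, (g x - Polynomial.eval x q)^2)
            ≤ C * Real.exp (-β₁ * p) ∧
        (∫ x in Ioo (0:ℝ) 1, (deriv (fun y => g y - Polynomial.eval y q) x)^2)
            ≤ C * (p:ℝ)^2 * Real.exp (-β₁ * p) := by
  have he0 : 0 < Real.exp 1 := Real.exp_pos 1
  have hK0 : 0 < K := by linarith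
  set β := 1 / (Real.exp 1 * K) with hβ
  have hβ0 : 0 < β := by positivity
  refine ⟨4 * C₀ ^ 2 * Real.exp 2 * (1 + 8 / β ^ 2), β / 2, by positivity, by positivity, ?_⟩
  intro ε hε hε1 g hg hbound κ hκ hκβ p hp
  simp only [SpectralApproximation.setIntegral_Ioo_eq] at hbound ⊢
  have hεp : ε⁻¹ ≤ p / (Real.exp 1 * K) := by
    have h1 : κ * p * ε ≤ β / 2 * p * ε := by gcongr
    rw [inv_le_iff_one_le_mul₀ hε, div_eq_mul_one_div, ← hβ]
    linarith
  obtain ⟨n, r, rfl, hr, hle⟩ := SpectralApproximation.exists_approx_deriv hK hC₀ hg hbound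
    ((one_le_inv₀ hε).2 hε1) hεp
  rw [← hβ] at hle
  obtain ⟨q, hq, h0, h1, hL2, hH1⟩ := SpectralApproximation.exists_interpolating
    (hg.of_le (by exact_mod_cast le_top)) hr hle
  refine ⟨q, hq, h0, h1, hL2.trans ?_, hH1.trans ?_⟩
  · rw [mul_assoc _ (1 + 8 / β ^ 2)]
    refine mul_le_mul_of_nonneg_left ?_ (by positivity)
    refine (SpectralApproximation.sq_mul_exp_neg_le hβ0 _).trans ?_
    exact mul_le_mul_of_nonneg_right (by linarith) (Real.exp_pos _).le
  · rw [← mul_assoc]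
    refine mul_le_mul (mul_le_mul_of_nonneg_right (le_mul_of_one_le_right (by positivity) ?_)
      (by positivity)) (Real.exp_le_exp.2 ?_) (Real.exp_pos _).le (by positivity)
    · exact le_add_of_nonneg_right (by positivity)
    · exact mul_le_mul_of_nonneg_right (by linarith) (Nat.cast_nonneg _)
end

section
/- Let K₁ > 0, C₀ > 0 and let g be a C^∞ function on [0,1] satisfying ‖g⁽ⁿ⁾‖_{∞,(0,1)} ≤ C₀ n! K₁ⁿ for all n ∈ ℕ₀. Then there exist constants C > 0 and σ > 0, depending only on C₀ and K₁, such that for every p ∈ ℕ, p ≥ 1, there is a polynomial q of degree at most p with q(0) = g(0), q(1) = g(1), and ‖g − q‖_{0,(0,1)} + ‖(g − q)'‖_{0,(0,1)} ≤ C p e^{−σ p}. -/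
open Set

/-- The differential operator `f ↦ x(1-x) f'' + (1/2-x) f'`, which is the second derivative in `θ`
under the substitution `x = (1 + cos θ) / 2`. -/
noncomputable def chebyshevOp (f : ℝ → ℝ) (x : ℝ) : ℝ :=
  x * (1 - x) * deriv (deriv f) x + (1 / 2 - x) * deriv f x

theorem contDiff_deriv_of_contDiff_infty {f : ℝ → ℝ} (hf : ContDiff ℝ (⊤ : ℕ∞) f) :
    ContDiff ℝ (⊤ : ℕ∞) (deriv f) :=
  (contDiff_infty_iff_deriv.mp hf).2

theorem contDiff_chebyshevOp {f : ℝ → ℝ} (hf : ContDiff ℝ (⊤ : ℕ∞) f) :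
    ContDiff ℝ (⊤ : ℕ∞) (chebyshevOp f) := by
  have h1 := contDiff_deriv_of_contDiff_infty hf
  have h2 := contDiff_deriv_of_contDiff_infty h1
  unfold chebyshevOp
  fun_prop

theorem hasDerivAt_iteratedDeriv {f : ℝ → ℝ} (hf : ContDiff ℝ (⊤ : ℕ∞) f) (k : ℕ) (x : ℝ) :
    HasDerivAt (iteratedDeriv k f) (iteratedDeriv (k + 1) f x) x := by
  rw [iteratedDeriv_succ]
  exact (hf.differentiable_iteratedDeriv k
    (by exact_mod_cast WithTop.coe_lt_top k) x).hasDerivAt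

theorem iteratedDeriv_chebyshevOp {f : ℝ → ℝ} (hf : ContDiff ℝ (⊤ : ℕ∞) f) (k : ℕ) (x : ℝ) :
    iteratedDeriv k (chebyshevOp f) x =
      x * (1 - x) * iteratedDeriv (k + 2) f x
        + (k + 1 / 2) * (1 - 2 * x) * iteratedDeriv (k + 1) f x
        - k ^ 2 * iteratedDeriv k f x := by
  induction k generalizing x with
  | zero =>
    simp only [iteratedDeriv_succ, iteratedDeriv_zero, chebyshevOp]
    push_cast
    ring
  | succ k ih =>
    rw [iteratedDeriv_succ, funext ih]
    have h0 := hasDerivAt_iteratedDeriv hf k x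
    have h1 := hasDerivAt_iteratedDeriv hf (k + 1) x
    have h2 := hasDerivAt_iteratedDeriv hf (k + 2) x
    have hx := hasDerivAt_id' x
    have := (((hx.mul (hx.const_sub 1)).mul h2).add
      (((((hx.const_mul 2).const_sub 1).const_mul ((k : ℝ) + 1 / 2))).mul h1)).sub
      (h0.const_mul ((k : ℝ) ^ 2))
    refine Eq.trans (this.deriv) ?_
    simp only [Pi.mul_apply]
    push_cast
    ring

/-- One application of `chebyshevOp` preserves factorial derivative bounds, shifting the
factorial by two. -/
theorem abs_iteratedDeriv_chebyshevOp_le {f : ℝ → ℝ} (hf : ContDiff ℝ (⊤ : ℕ∞) f) {M K : ℝ}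
    (_hM : 0 ≤ M) (_hK : 0 ≤ K) {r : ℕ}
    (hb : ∀ k : ℕ, ∀ x ∈ Icc (0 : ℝ) 1, |iteratedDeriv k f x| ≤ M * (k + r).factorial * K ^ k)
    (k : ℕ) {x : ℝ} (hx : x ∈ Icc (0 : ℝ) 1) :
    |iteratedDeriv k (chebyshevOp f) x| ≤
      M * (K / 2 + 1) ^ 2 * (k + (r + 2)).factorial * K ^ k := by
  rw [iteratedDeriv_chebyshevOp hf]
  obtain ⟨hx0, hx1⟩ := hx
  have h0 := hb k x ⟨hx0, hx1⟩
  have h1 := hb (k + 1) x ⟨hx0, hx1⟩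
  have h2 := hb (k + 2) x ⟨hx0, hx1⟩
  set N : ℝ := ((k + r).factorial : ℝ)
  have hN : 0 ≤ N := by positivity
  have e1 : ((k + 1 + r).factorial : ℝ) = (k + r + 1) * N := by
    rw [show k + 1 + r = (k + r) + 1 by ring, Nat.factorial_succ]; push_cast; ring
  have e2 : ((k + 2 + r).factorial : ℝ) = (k + r + 2) * (k + r + 1) * N := by
    rw [show k + 2 + r = (k + r) + 1 + 1 by ring, Nat.factorial_succ, Nat.factorial_succ]
    push_cast; ring
  rw [show k + (r + 2) = k + 2 + r by ring, e2]
  rw [e1] at h1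
  rw [e2] at h2
  have hk : (0 : ℝ) ≤ k := by positivity
  have hr : (0 : ℝ) ≤ r := by positivity
  have a2 : |x * (1 - x)| ≤ 1 / 4 := by
    rw [abs_of_nonneg (mul_nonneg hx0 (by linarith))]; nlinarith [sq_nonneg (x - 1 / 2)]
  have a1 : |((k : ℝ) + 1 / 2) * (1 - 2 * x)| ≤ k + r + 2 := by
    rw [abs_mul, abs_of_nonneg (by positivity : (0 : ℝ) ≤ k + 1 / 2)]
    have : |1 - 2 * x| ≤ 1 := abs_le.2 ⟨by linarith, by linarith⟩
    nlinarith
  have a0 : |(k : ℝ) ^ 2| ≤ (k + r + 2) * (k + r + 1) := by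
    rw [abs_of_nonneg (by positivity)]; nlinarith [mul_nonneg hk hr]
  calc _ ≤ |x * (1 - x)| * |iteratedDeriv (k + 2) f x|
        + |((k : ℝ) + 1 / 2) * (1 - 2 * x)| * |iteratedDeriv (k + 1) f x|
        + |(k : ℝ) ^ 2| * |iteratedDeriv k f x| := by
        rw [← abs_mul, ← abs_mul, ← abs_mul]
        exact (abs_sub _ _).trans (add_le_add_left (abs_add_le _ _) _)
    _ ≤ 1 / 4 * (M * ((k + r + 2) * (k + r + 1) * N) * K ^ (k + 2))
        + (k + r + 2) * (M * ((k + r + 1) * N) * K ^ (k + 1))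
        + (k + r + 2) * (k + r + 1) * (M * N * K ^ k) := by gcongr
    _ = _ := by ring

theorem abs_iterate_chebyshevOp_le {f : ℝ → ℝ} (hf : ContDiff ℝ (⊤ : ℕ∞) f) {M K : ℝ}
    (hM : 0 ≤ M) (hK : 0 ≤ K)
    (hb : ∀ k : ℕ, ∀ x ∈ Icc (0 : ℝ) 1, |iteratedDeriv k f x| ≤ M * (k + 1).factorial * K ^ k)
    (m : ℕ) :
    ContDiff ℝ (⊤ : ℕ∞) (chebyshevOp^[m] f) ∧ ∀ k : ℕ, ∀ x ∈ Icc (0 : ℝ) 1,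
      |iteratedDeriv k (chebyshevOp^[m] f) x| ≤
        M * (K / 2 + 1) ^ (2 * m) * (k + (2 * m + 1)).factorial * K ^ k := by
  induction m with
  | zero => simpa using ⟨hf, fun k x h0 h1 => hb k x ⟨h0, h1⟩⟩
  | succ m ih =>
    rw [Function.iterate_succ_apply']
    refine ⟨contDiff_chebyshevOp ih.1, fun k x hx => ?_⟩
    refine (abs_iteratedDeriv_chebyshevOp_le ih.1 (by positivity) hK ih.2 k hx).trans_eq ?_
    rw [show 2 * (m + 1) + 1 = 2 * m + 1 + 2 by ring]
    ring

theorem hasDerivAt_cexp_neg_int_mul (n : ℤ) (θ : ℝ) :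
    HasDerivAt (fun t : ℝ => Complex.exp (-(n * t * Complex.I)))
      (-(n * Complex.I) * Complex.exp (-(n * θ * Complex.I))) θ := by
  have h : HasDerivAt (fun t : ℝ => -((n : ℂ) * t * Complex.I)) (-(n * Complex.I)) θ := by
    have := (((Complex.ofRealCLM.hasDerivAt (x := θ)).const_mul (n : ℂ)).mul_const Complex.I).neg
    simpa [Pi.neg_def] using this
  convert h.cexp using 1
  ring

theorem integral_cexp_mul_deriv_of_eq {u u' : ℝ → ℝ} (hu : ∀ θ, HasDerivAt u (u' θ) θ)
    (hu' : Continuous u') (hper : u (2 * Real.pi) = u 0) (n : ℤ) :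
    ∫ θ in (0 : ℝ)..2 * Real.pi, Complex.exp (-(n * θ * Complex.I)) * (u' θ : ℂ) =
      n * Complex.I *
        ∫ θ in (0 : ℝ)..2 * Real.pi, Complex.exp (-(n * θ * Complex.I)) * (u θ : ℂ) := by
  rw [intervalIntegral.integral_mul_deriv_eq_deriv_mul (v := fun θ => (u θ : ℂ))
    (fun θ _ => hasDerivAt_cexp_neg_int_mul n θ) (fun θ _ => (hu θ).ofReal_comp)
    ((by fun_prop : Continuous _).intervalIntegrable _ _)
    ((by fun_prop : Continuous _).intervalIntegrable _ _), hper]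
  have : Complex.exp (-(n * ((2 * Real.pi : ℝ) : ℂ) * Complex.I)) = 1 := by
    rw [Complex.exp_eq_one_iff]
    exact ⟨-n, by push_cast; ring⟩
  rw [this]
  simp only [mul_assoc, neg_mul, intervalIntegral.integral_neg]
  simp only [intervalIntegral.integral_const_mul]
  simp

/-- The unnormalised `n`-th Fourier coefficient of `θ ↦ f ((1 + cos θ) / 2)`. -/
noncomputable def chebyshevInt (f : ℝ → ℝ) (n : ℤ) : ℂ :=
  ∫ θ in (0 : ℝ)..2 * Real.pi,
    Complex.exp (-(n * θ * Complex.I)) * (f ((1 + Real.cos θ) / 2) : ℂ)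

theorem chebyshevInt_chebyshevOp {f : ℝ → ℝ} (hf : ContDiff ℝ (⊤ : ℕ∞) f) (n : ℤ) :
    chebyshevInt (chebyshevOp f) n = -(n : ℂ) ^ 2 * chebyshevInt f n := by
  have h1 := contDiff_deriv_of_contDiff_infty hf
  have hc : ∀ θ : ℝ, HasDerivAt (fun t => (1 + Real.cos t) / 2) (-Real.sin θ / 2) θ := fun θ =>
    ((Real.hasDerivAt_cos θ).const_add 1).div_const 2
  have hd : ∀ {h : ℝ → ℝ}, ContDiff ℝ (⊤ : ℕ∞) h → ∀ θ : ℝ,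
      HasDerivAt (fun t => h ((1 + Real.cos t) / 2))
        (deriv h ((1 + Real.cos θ) / 2) * (-Real.sin θ / 2)) θ := fun hh θ =>
    ((hh.differentiable (by simp) _).hasDerivAt).comp θ (hc θ)
  have hdd : ∀ θ : ℝ, HasDerivAt
      (fun t => deriv f ((1 + Real.cos t) / 2) * (-Real.sin t / 2))
      (chebyshevOp f ((1 + Real.cos θ) / 2)) θ := fun θ => by
    refine ((hd h1 θ).mul ((Real.hasDerivAt_sin θ).neg.div_const 2)).congr_deriv ?_
    have := Real.sin_sq_add_cos_sq θ
    simp only [chebyshevOp, Pi.neg_apply]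
    linear_combination (deriv (deriv f) ((1 + Real.cos θ) / 2) / 4) * this
  have c1 := h1.continuous
  have c2 := (contDiff_chebyshevOp hf).continuous
  unfold chebyshevInt
  rw [integral_cexp_mul_deriv_of_eq hdd (by fun_prop) (by simp),
    integral_cexp_mul_deriv_of_eq (hd hf) (by fun_prop) (by simp)]
  linear_combination (n : ℂ) ^ 2 * (∫ θ in (0 : ℝ)..2 * Real.pi,
    Complex.exp (-(n * θ * Complex.I)) * (f ((1 + Real.cos θ) / 2) : ℂ)) * Complex.I_sq

theorem chebyshevInt_iterate {f : ℝ → ℝ} (hf : ContDiff ℝ (⊤ : ℕ∞) f) (n : ℤ) (m : ℕ) :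
    chebyshevInt (chebyshevOp^[m] f) n = (-(n : ℂ) ^ 2) ^ m * chebyshevInt f n := by
  induction m generalizing f with
  | zero => simp
  | succ m ih =>
    rw [Function.iterate_succ_apply, ih (contDiff_chebyshevOp hf), chebyshevInt_chebyshevOp hf]
    ring

theorem half_one_add_cos_mem (θ : ℝ) : (1 + Real.cos θ) / 2 ∈ Icc (0 : ℝ) 1 :=
  ⟨by linarith [Real.neg_one_le_cos θ], by linarith [Real.cos_le_one θ]⟩

theorem norm_chebyshevInt_le {f : ℝ → ℝ} {A : ℝ} (hA : ∀ x ∈ Icc (0 : ℝ) 1, |f x| ≤ A) (n : ℤ) :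
    ‖chebyshevInt f n‖ ≤ 2 * Real.pi * A := by
  refine (intervalIntegral.norm_integral_le_of_norm_le_const (C := A) fun θ _ => ?_).trans_eq ?_
  · rw [norm_mul, Complex.norm_exp, Complex.norm_real]
    simpa using hA _ (half_one_add_cos_mem θ)
  · rw [sub_zero, abs_of_pos Real.two_pi_pos, mul_comm]

theorem exp_decay_of_factorial_bound {B : ℝ} (hB : 1 ≤ B) {a M : ℝ} (hM : 0 ≤ M) (n : ℕ)
    (h : ∀ m : ℕ, ((n : ℝ) ^ 2) ^ m * a ≤ M * B ^ (2 * m) * (2 * m + 1).factorial) :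
    a ≤ 4 * M * Real.exp (-(Real.log 2 / (4 * B)) * n) := by
  have hB0 : 0 < B := by linarith
  rcases Nat.eq_zero_or_pos n with rfl | hn
  · have := h 0
    norm_num at this ⊢
    linarith
  set m := ⌊(n : ℝ) / (8 * B)⌋₊
  have hm1 : (m : ℝ) ≤ n / (8 * B) := Nat.floor_le (by positivity)
  have hm2 : (n : ℝ) / (8 * B) < m + 1 := Nat.lt_floor_add_one _
  have hn0 : (0 : ℝ) < n := by exact_mod_cast hn
  have hfac : ((2 * m + 1).factorial : ℝ) ≤ 2 ^ (2 * m) * (2 * m : ℝ) ^ (2 * m) := by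
    have h1 : 2 * m + 1 ≤ 2 ^ (2 * m) := Nat.lt_two_pow_self
    have h2 := Nat.factorial_le_pow (2 * m)
    rw [Nat.factorial_succ]
    exact_mod_cast Nat.mul_le_mul h1 h2
  have hkey : 4 * B * (2 * m) ≤ n := by
    rw [le_div_iff₀ (by positivity)] at hm1; linarith
  have h3 : (n : ℝ) ^ (2 * m) * (a * 2 ^ (2 * m)) ≤ (n : ℝ) ^ (2 * m) * M := by
    calc (n : ℝ) ^ (2 * m) * (a * 2 ^ (2 * m)) = (((n : ℝ) ^ 2) ^ m * a) * 2 ^ (2 * m) := by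
          rw [← pow_mul]; ring
      _ ≤ (M * B ^ (2 * m) * (2 ^ (2 * m) * (2 * m : ℝ) ^ (2 * m))) * 2 ^ (2 * m) := by
          refine mul_le_mul_of_nonneg_right ((h m).trans ?_) (by positivity)
          gcongr
      _ = M * (4 * B * (2 * m)) ^ (2 * m) := by
          rw [mul_pow (4 * B), mul_pow 4, show (4 : ℝ) = 2 * 2 by norm_num, mul_pow 2 2]; ring
      _ ≤ M * (n : ℝ) ^ (2 * m) := by gcongr
      _ = _ := mul_comm _ _
  have h4 : a * 2 ^ (2 * m) ≤ M := le_of_mul_le_mul_left h3 (by positivity)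
  have h5 : (1 : ℝ) ≤ 4 * 2 ^ (2 * m) * Real.exp (-(Real.log 2 / (4 * B)) * n) := by
    have e : (4 : ℝ) * 2 ^ (2 * m) = Real.exp (Real.log 2 * (2 * m + 2)) := by
      rw [← Real.rpow_def_of_pos (by norm_num : (0 : ℝ) < 2), Real.rpow_add (by norm_num)]
      rw [show (2 : ℝ) * m = ((2 * m : ℕ) : ℝ) by push_cast; ring, Real.rpow_natCast]
      norm_num [mul_comm]
    rw [e, ← Real.exp_add, Real.one_le_exp_iff]
    have hl := Real.log_pos (by norm_num : (1 : ℝ) < 2)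
    have : Real.log 2 / (4 * B) * n = Real.log 2 * (2 * (n / (8 * B))) := by field_simp; ring
    rw [neg_mul, this, ← sub_eq_add_neg, ← mul_sub]
    exact mul_nonneg hl.le (by linarith)
  set E := Real.exp (-(Real.log 2 / (4 * B)) * n)
  have hE : 0 < E := Real.exp_pos _
  rcases le_or_gt a 0 with ha | ha
  · exact ha.trans (by positivity)
  · nlinarith [mul_le_mul_of_nonneg_left h5 ha.le, mul_le_mul_of_nonneg_right h4 hE.le]

theorem norm_chebyshevInt_le_exp {f : ℝ → ℝ} (hf : ContDiff ℝ (⊤ : ℕ∞) f) {M K : ℝ}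
    (hM : 0 ≤ M) (hK : 0 ≤ K)
    (hb : ∀ k : ℕ, ∀ x ∈ Icc (0 : ℝ) 1, |iteratedDeriv k f x| ≤ M * (k + 1).factorial * K ^ k)
    (n : ℤ) :
    ‖chebyshevInt f n‖ ≤
      4 * (2 * Real.pi * M) * Real.exp (-(Real.log 2 / (4 * (K / 2 + 1))) * n.natAbs) := by
  refine exp_decay_of_factorial_bound (by linarith) (by positivity) n.natAbs fun m => ?_
  have h1 := (abs_iterate_chebyshevOp_le hf hM hK hb m).2 0
  simp only [iteratedDeriv_zero, zero_add, pow_zero, mul_one] at h1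
  have h2 := norm_chebyshevInt_le h1 n
  rw [chebyshevInt_iterate hf, norm_mul, norm_pow, norm_neg, norm_pow, Complex.norm_intCast] at h2
  rw [Nat.cast_natAbs, Int.cast_abs]
  exact h2.trans_eq (by ring)

theorem summable_exp_neg_mul_natAbs {σ : ℝ} (hσ : 0 < σ) :
    Summable fun n : ℤ => Real.exp (-σ * n.natAbs) := by
  have h : Summable fun n : ℕ => Real.exp (-σ * n) := by
    simp_rw [mul_comm (-σ)]
    exact Real.summable_exp_nat_mul_iff.2 (by linarith)
  exact .of_nat_of_neg (by simpa using h) (by simpa using h)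

theorem hasSum_chebyshev {f : ℝ → ℝ} (hf : Continuous f) (hs : Summable (chebyshevInt f))
    (θ : ℝ) :
    HasSum (fun n : ℤ => (chebyshevInt f n).re / (2 * Real.pi) * Real.cos (n * θ))
      (f ((1 + Real.cos θ) / 2)) := by
  have hT : Fact (0 < 2 * Real.pi) := ⟨Real.two_pi_pos⟩
  have hpi : (Real.pi : ℂ) ≠ 0 := by exact_mod_cast Real.pi_ne_zero
  have hper : Function.Periodic (fun t : ℝ => (f ((1 + Real.cos t) / 2) : ℂ)) (2 * Real.pi) :=
    fun t => by simp
  let G : C(AddCircle (2 * Real.pi), ℂ) :=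
    ⟨hper.lift, continuous_coinduced_dom.mpr (by
      change Continuous fun t : ℝ => (f ((1 + Real.cos t) / 2) : ℂ)
      fun_prop)⟩
  have hG : ∀ t : ℝ, G (t : AddCircle (2 * Real.pi)) = (f ((1 + Real.cos t) / 2) : ℂ) :=
    fun t => hper.lift_coe t
  have hexp : ∀ (n : ℤ) (t : ℝ), fourier n (t : AddCircle (2 * Real.pi)) =
      Complex.exp (n * t * Complex.I) := fun n t => by
    rw [fourier_coe_apply]
    congr 1
    push_cast
    field_simp
  have hco : ∀ n : ℤ, fourierCoeff G n = chebyshevInt f n / (2 * Real.pi) := fun n => by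
    rw [fourierCoeff_eq_intervalIntegral G n 0, zero_add, chebyshevInt]
    simp only [hexp, hG, smul_eq_mul, Complex.real_smul]
    push_cast
    simp only [neg_mul]
    ring
  have hsG : Summable (fourierCoeff G) := by
    rw [funext hco]
    exact hs.div_const _
  have hsum : ∀ t : ℝ, HasSum (fun n : ℤ => chebyshevInt f n / (2 * Real.pi) *
      Complex.exp (n * t * Complex.I)) (f ((1 + Real.cos t) / 2) : ℂ) := fun t => by
    simpa only [hco, hexp, hG, smul_eq_mul] using
      has_pointwise_sum_fourier_series_of_summable hsG (t : AddCircle (2 * Real.pi))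
  have h := Complex.hasSum_re (((hsum θ).add (hsum (-θ))).div_const 2)
  rw [Real.cos_neg, add_self_div_two, Complex.ofReal_re] at h
  convert h using 2 with n
  have : chebyshevInt f n / (2 * Real.pi) * Complex.exp (n * θ * Complex.I) +
      chebyshevInt f n / (2 * Real.pi) * Complex.exp (n * (-θ : ℝ) * Complex.I) =
      chebyshevInt f n * ((1 / (2 * Real.pi) * Real.cos (n * θ) : ℝ) : ℂ) * 2 := by
    push_cast
    rw [Complex.cos]
    simp only [mul_neg, neg_mul]
    ring
  rw [this, mul_div_cancel_right₀ _ two_ne_zero, Complex.re_mul_ofReal]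
  ring

theorem abs_sub_sum_le_of_exp_decay {u : ℤ → ℝ} {F A σ : ℝ} (hA : 0 ≤ A) (hσ : 0 < σ)
    (hu : HasSum u F) (hb : ∀ n, |u n| ≤ A * Real.exp (-(2 * σ) * n.natAbs)) (p : ℕ) :
    |F - ∑ n ∈ Finset.Ioo (-p : ℤ) p, u n| ≤
      A * (∑' n : ℤ, Real.exp (-σ * n.natAbs)) * Real.exp (-σ * p) := by
  set S := Finset.Ioo (-p : ℤ) p
  have h1 : HasSum (fun n => if n ∈ S then u n else 0) (∑ n ∈ S, u n) := by
    convert hasSum_sum_of_ne_finset_zero (L := .unconditional ℤ) (f := fun n => if n ∈ S then u n else 0) (s := S)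
      (fun n hn => if_neg hn) using 1
    exact Finset.sum_congr rfl fun n hn => (if_pos hn).symm
  refine (hu.sub h1).norm_le_of_bounded
    (((summable_exp_neg_mul_natAbs hσ).hasSum.mul_left A).mul_right _) fun n => ?_
  by_cases hn : n ∈ S
  · simp only [hn, if_true, sub_self, norm_zero]
    positivity
  · simp only [hn, if_false, sub_zero, Real.norm_eq_abs]
    refine (hb n).trans ?_
    rw [mul_assoc, ← Real.exp_add]
    have hp : p ≤ n.natAbs := by
      simp only [S, Finset.mem_Ioo] at hn
      omega
    have hp' : (p : ℝ) ≤ n.natAbs := by exact_mod_cast hp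
    gcongr
    nlinarith

theorem natDegree_comp_affine_chebyshev_le (n : ℤ) :
    ((Polynomial.Chebyshev.T ℝ n).comp (2 * Polynomial.X - 1)).natDegree ≤ n.natAbs := by
  refine Polynomial.natDegree_comp_le.trans ?_
  have h1 : (Polynomial.Chebyshev.T ℝ n).natDegree ≤ n.natAbs :=
    Polynomial.natDegree_le_of_degree_le (Polynomial.Chebyshev.degree_T ℝ n).le
  have h2 : (2 * Polynomial.X - 1 : Polynomial ℝ).natDegree ≤ 1 := by compute_degree
  exact (Nat.mul_le_mul h1 h2).trans_eq (mul_one _)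

/-- Uniform exponential approximation by polynomials on `[0, 1]`. -/
theorem exists_polynomial_uniform_approx (K M : ℝ) (hK : 0 ≤ K) (hM : 0 < M) :
    ∃ D σ : ℝ, 0 < D ∧ 0 < σ ∧ ∀ f : ℝ → ℝ, ContDiff ℝ (⊤ : ℕ∞) f →
      (∀ k : ℕ, ∀ x ∈ Icc (0 : ℝ) 1, |iteratedDeriv k f x| ≤ M * (k + 1).factorial * K ^ k) →
      ∀ p : ℕ, ∃ r : Polynomial ℝ, r.natDegree ≤ p - 1 ∧
        ∀ x ∈ Icc (0 : ℝ) 1, |f x - r.eval x| ≤ D * Real.exp (-σ * p) := by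
  set τ : ℝ := Real.log 2 / (4 * (K / 2 + 1))
  have hτ : 0 < τ := div_pos (Real.log_pos (by norm_num)) (by positivity)
  have hsum := summable_exp_neg_mul_natAbs (half_pos hτ)
  refine ⟨4 * M * ∑' n : ℤ, Real.exp (-(τ / 2) * n.natAbs), τ / 2,
    mul_pos (by positivity) (hsum.tsum_pos (fun _ => (Real.exp_pos _).le) 0 (Real.exp_pos _)),
    half_pos hτ, fun f hf hb p => ?_⟩
  have hdecay := norm_chebyshevInt_le_exp hf hM.le hK hb
  have hs : Summable (chebyshevInt f) :=
    .of_norm_bounded ((summable_exp_neg_mul_natAbs hτ).mul_left _) hdecay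
  refine ⟨∑ n ∈ Finset.Ioo (-p : ℤ) p, Polynomial.C ((chebyshevInt f n).re / (2 * Real.pi)) *
    (Polynomial.Chebyshev.T ℝ n).comp (2 * Polynomial.X - 1), ?_, fun x hx => ?_⟩
  · refine Polynomial.natDegree_sum_le_of_forall_le _ _ fun n hn => ?_
    refine (Polynomial.natDegree_C_mul_le _ _).trans
      ((natDegree_comp_affine_chebyshev_le n).trans ?_)
    simp only [Finset.mem_Ioo] at hn
    omega
  · obtain ⟨hx0, hx1⟩ := hx
    have hcos : Real.cos (Real.arccos (2 * x - 1)) = 2 * x - 1 :=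
      Real.cos_arccos (by linarith) (by linarith)
    have h := hasSum_chebyshev hf.continuous hs (Real.arccos (2 * x - 1))
    rw [hcos, show (1 + (2 * x - 1)) / 2 = x by ring] at h
    convert abs_sub_sum_le_of_exp_decay (A := 4 * M) (by positivity) (half_pos hτ) h
      (fun n => ?_) p using 3
    · rw [Polynomial.eval_finsetSum]
      refine Finset.sum_congr rfl fun n _ => ?_
      rw [← Polynomial.Chebyshev.T_real_cos, hcos]
      simp
    · rw [mul_div_cancel₀ _ two_ne_zero, abs_mul, abs_div, abs_of_pos Real.two_pi_pos]
      calc _ ≤ |(chebyshevInt f n).re| / (2 * Real.pi) * 1 := by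
            gcongr
            exact Real.abs_cos_le_one _
        _ ≤ 4 * (2 * Real.pi * M) * Real.exp (-τ * n.natAbs) / (2 * Real.pi) := by
            rw [mul_one]
            gcongr
            exact (Complex.abs_re_le_norm _).trans (hdecay n)
        _ = _ := by field_simp

theorem exists_polynomial_derivative_eq (r : Polynomial ℝ) :
    ∃ R : Polynomial ℝ, R.derivative = r ∧ R.natDegree ≤ r.natDegree + 1 := by
  refine ⟨∑ i ∈ Finset.range (r.natDegree + 1),
    Polynomial.monomial (i + 1) (r.coeff i / (i + 1)), ?_, ?_⟩
  · conv_rhs => rw [r.as_sum_range]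
    rw [Polynomial.derivative_sum]
    refine Finset.sum_congr rfl fun i _ => ?_
    rw [Polynomial.derivative_monomial]
    congr 1
    push_cast
    field_simp
  · refine Polynomial.natDegree_sum_le_of_forall_le _ _ fun i hi => ?_
    have := Finset.mem_range.1 hi
    exact (Polynomial.natDegree_monomial_le _).trans (by omega)

theorem sqrt_integral_sq_le {h : ℝ → ℝ} {A : ℝ} (hA : 0 ≤ A)
    (hb : ∀ x ∈ Ioo (0 : ℝ) 1, |h x| ≤ A) :
    Real.sqrt (∫ x in Ioo (0 : ℝ) 1, h x ^ 2) ≤ A := by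
  refine Real.sqrt_le_iff.2 ⟨hA, (le_abs_self _).trans ?_⟩
  refine (MeasureTheory.norm_setIntegral_le_of_norm_le_const (μ := MeasureTheory.volume)
    (s := Ioo (0 : ℝ) 1) (f := fun x => h x ^ 2) (C := A ^ 2) (by simp) fun x hx => ?_).trans_eq
    (by simp)
  rw [norm_pow]
  exact pow_le_pow_left₀ (norm_nonneg _) (hb x hx) 2

/-- Given a polynomial uniformly close to `g'`, integrate and correct by a linear term to
interpolate `g` at both endpoints. -/
theorem exists_polynomial_interpolating_of_deriv_approx {g : ℝ → ℝ} (hg : Differentiable ℝ g)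
    {r : Polynomial ℝ} {ε : ℝ} (hr : ∀ x ∈ Icc (0 : ℝ) 1, |deriv g x - r.eval x| ≤ ε) :
    ∃ q : Polynomial ℝ, q.natDegree ≤ r.natDegree + 1 ∧ q.eval 0 = g 0 ∧ q.eval 1 = g 1 ∧
      (∀ x ∈ Icc (0 : ℝ) 1, |g x - q.eval x| ≤ 2 * ε) ∧
      ∀ x ∈ Icc (0 : ℝ) 1, |deriv (fun y => g y - q.eval y) x| ≤ 2 * ε := by
  obtain ⟨R, hR, hRdeg⟩ := exists_polynomial_derivative_eq r
  have hd : ∀ (q : Polynomial ℝ) (x : ℝ),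
      HasDerivAt (fun y => g y - q.eval y) (deriv g x - q.derivative.eval x) x :=
    fun q x => (hg x).hasDerivAt.sub (q.hasDerivAt x)
  have mvt : ∀ (q : Polynomial ℝ) (δ : ℝ),
      (∀ x ∈ Icc (0 : ℝ) 1, |deriv g x - q.derivative.eval x| ≤ δ) → 0 ≤ δ →
      ∀ x ∈ Icc (0 : ℝ) 1, |(g x - q.eval x) - (g 0 - q.eval 0)| ≤ δ := fun q δ hq hδ x hx => by
    have := (convex_Icc (0 : ℝ) 1).norm_image_sub_le_of_norm_hasDerivWithin_le
      (fun y _ => (hd q y).hasDerivWithinAt) hq ⟨le_rfl, zero_le_one⟩ hx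
    refine this.trans ?_
    rw [sub_zero, Real.norm_of_nonneg hx.1]
    exact mul_le_of_le_one_right hδ hx.2
  have hε : 0 ≤ ε := (abs_nonneg _).trans (hr 0 ⟨le_rfl, zero_le_one⟩)
  set c := (g 1 - R.eval 1) - (g 0 - R.eval 0) with hc
  have hcε : |c| ≤ ε := mvt R ε (by rwa [hR]) hε 1 ⟨zero_le_one, le_rfl⟩
  set q := R + (Polynomial.C c * Polynomial.X + Polynomial.C (g 0 - R.eval 0)) with hq
  have hq0 : q.eval 0 = g 0 := by simp [hq]
  have hqd : ∀ x ∈ Icc (0 : ℝ) 1, |deriv g x - q.derivative.eval x| ≤ 2 * ε := fun x hx => by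
    have : deriv g x - q.derivative.eval x = (deriv g x - r.eval x) - c := by
      simp [hq, hR]
      ring
    rw [this, two_mul]
    exact (abs_sub _ _).trans (add_le_add (hr x hx) hcε)
  refine ⟨q, ?_, hq0, ?_, fun x hx => ?_, fun x hx => ?_⟩
  · refine Polynomial.natDegree_add_le_of_degree_le hRdeg
      (Polynomial.natDegree_linear_le.trans (by omega))
  · simp [hq, hc]
  · simpa [hq0] using mvt q _ hqd (by positivity) x hx
  · rw [(hd q x).deriv]
    exact hqd x hx

/-- Exponential approximation of the smooth (analytic) part: if
`‖g⁽ⁿ⁾‖_{∞,(0,1)} ≤ C₀ n! K₁ⁿ` for all `n`, then there are `C, σ > 0`, depending only on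
`C₀, K₁`, such that for every `p ≥ 1` there is a polynomial `q` of degree `≤ p` matching
`g` at `0, 1` with `‖g - q‖₀ + ‖(g - q)'‖₀ ≤ C p e^{-σ p}`. -/
theorem smooth_part_approximation
    (K₁ C₀ : ℝ) (hK₁ : 0 < K₁) (hC₀ : 0 < C₀) :
    ∃ C σ : ℝ, 0 < C ∧ 0 < σ ∧
      ∀ g : ℝ → ℝ, ContDiff ℝ (⊤ : ℕ∞) g →
      (∀ n : ℕ, ∀ x ∈ Ioo (0:ℝ) 1,
        |iteratedDeriv n g x| ≤ C₀ * (n.factorial : ℝ) * K₁ ^ n) →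
      ∀ p : ℕ, 1 ≤ p →
      ∃ q : Polynomial ℝ, q.natDegree ≤ p ∧
        Polynomial.eval 0 q = g 0 ∧ Polynomial.eval 1 q = g 1 ∧
        Real.sqrt (∫ x in Ioo (0:ℝ) 1, (g x - Polynomial.eval x q)^2)
          + Real.sqrt (∫ x in Ioo (0:ℝ) 1, (deriv (fun y => g y - Polynomial.eval y q) x)^2)
          ≤ C * p * Real.exp (-σ * p) := by
  obtain ⟨D, σ, hD, hσ, H⟩ :=
    exists_polynomial_uniform_approx K₁ (C₀ * K₁) hK₁.le (mul_pos hC₀ hK₁)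
  refine ⟨4 * D, σ, by positivity, hσ, fun g hg hb p hp => ?_⟩
  have hb' : ∀ k : ℕ, ∀ x ∈ Icc (0 : ℝ) 1,
      |iteratedDeriv k (deriv g) x| ≤ C₀ * K₁ * (k + 1).factorial * K₁ ^ k := fun k x hx => by
    rw [← iteratedDeriv_succ']
    have hclosed : IsClosed {y | |iteratedDeriv (k + 1) g y| ≤
        C₀ * ((k + 1).factorial : ℝ) * K₁ ^ (k + 1)} :=
      isClosed_le (hg.continuous_iteratedDeriv (k + 1)
        (by exact_mod_cast le_top)).abs continuous_const
    rw [← closure_Ioo zero_ne_one] at hx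
    exact (closure_minimal (hb (k + 1)) hclosed hx : |_| ≤ _).trans_eq (by ring)
  obtain ⟨r, hrdeg, hr⟩ := H _ (contDiff_deriv_of_contDiff_infty hg) hb' p
  obtain ⟨q, hqdeg, hq0, hq1, hq, hq'⟩ :=
    exists_polynomial_interpolating_of_deriv_approx (hg.differentiable (by simp)) hr
  refine ⟨q, by omega, hq0, hq1, ?_⟩
  have hp' : (1 : ℝ) ≤ p := by exact_mod_cast hp
  have hE := Real.exp_pos (-σ * p)
  refine (add_le_add
    (sqrt_integral_sq_le (by positivity) fun x hx => hq x (Ioo_subset_Icc_self hx))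
    (sqrt_integral_sq_le (by positivity) fun x hx => hq' x (Ioo_subset_Icc_self hx))).trans ?_
  have := mul_le_mul_of_nonneg_left hp' (by positivity : 0 ≤ 4 * D * Real.exp (-σ * p))
  linarith
end
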